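/- arXiv:2012.00122 — 5 statements merged into one kernel-verified Lean document; each statement's English description precedes it below -/
import Mathlib

section
/- For every n ≥ 1, the reflection S(wd) of a weighted Dyck path wd ∈ WD_{2n} (reading the path from right to left, exchanging up-steps and down-steps, and reversing the weight sequence) again belongs to WD_{2n}; moreover S is an involution on WD_{2n}. -/
/-- A weighted lattice path: a list of steps (`true` = up-step `(1,1)`,
`false` = down-step `(1,-1)`) together with a list of weights, one per step. -/
structure WDP where
  steps : List Bool
  weights : List ℕ

/-- Height of the path after the first `k` steps. -/
def ht (s : List Bool) (k : ℕ) : ℕ :=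
  (s.take k).count true - (s.take k).count false

/-- `s` is a Dyck path: every prefix has at least as many up-steps as
down-steps, and the total numbers of up-steps and down-steps agree. -/
def IsDyck (s : List Bool) : Prop :=
  (∀ k, (s.take k).count false ≤ (s.take k).count true) ∧
    s.count false = s.count true

/-- `p` is a weighted Dyck path in `WD_{2n}`. -/
def IsWD (n : ℕ) (p : WDP) : Prop :=
  p.steps.length = 2 * n ∧ p.weights.length = 2 * n ∧ IsDyck p.steps ∧
  -- (1) each weight is at most the lower height of its step
  (∀ i < 2 * n,
    p.weights.getD i 0 ≤ min (ht p.steps i) (ht p.steps (i + 1))) ∧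
  -- (2) weights are non-decreasing along consecutive up-steps
  (∀ i, i + 1 < 2 * n → p.steps.getD i false = true → p.steps.getD (i + 1) false = true →
    p.weights.getD i 0 ≤ p.weights.getD (i + 1) 0) ∧
  -- (3) weights are non-increasing along consecutive down-steps
  (∀ i, i + 1 < 2 * n → p.steps.getD i false = false → p.steps.getD (i + 1) false = false →
    p.weights.getD (i + 1) 0 ≤ p.weights.getD i 0) ∧
  -- (4) peak condition: e + d ≤ h
  (∀ i, i + 1 < 2 * n → p.steps.getD i false = true → p.steps.getD (i + 1) false = false →
    p.weights.getD i 0 + p.weights.getD (i + 1) 0 ≤ ht p.steps (i + 1)) ∧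
  -- (5) valley condition: d + e ≥ h
  (∀ i, i + 1 < 2 * n → p.steps.getD i false = false → p.steps.getD (i + 1) false = true →
    ht p.steps (i + 1) ≤ p.weights.getD i 0 + p.weights.getD (i + 1) 0)

/-- Reflection (Schützenberger involution) of a weighted Dyck path: read the
path from right to left, exchanging up-steps and down-steps, keeping the
weight of each step. -/
def reflectWD (p : WDP) : WDP :=
  ⟨(p.steps.map (fun b => !b)).reverse, p.weights.reverse⟩

theorem count_take_reverse_map_not (s : List Bool) (k : ℕ) (b : Bool) :
    (((s.map (fun b => !b)).reverse).take k).count b + (s.take (s.length - k)).count (!b) =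
      s.count (!b) := by
  have hsplit := congrArg (List.count (!b)) (List.take_append_drop (s.length - k) s)
  have hnot := List.count_map_of_injective (s.drop (s.length - k)) (fun b => !b)
    Bool.not_injective (!b)
  rw [List.count_append] at hsplit
  rw [Bool.not_not] at hnot
  rw [List.take_reverse, List.count_reverse, List.length_map, ← List.map_drop, hnot]
  omega

theorem IsDyck.reverse_map_not {s : List Bool} (hs : IsDyck s) :
    IsDyck (s.map (fun b => !b)).reverse := by
  obtain ⟨hprefix, htotal⟩ := hs
  refine ⟨fun k => ?_, ?_⟩
  · have ht := count_take_reverse_map_not s k true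
    have hf := count_take_reverse_map_not s k false
    have := hprefix (s.length - k)
    simp only [Bool.not_true, Bool.not_false] at ht hf
    omega
  · have ht := List.count_map_of_injective s (fun b => !b) Bool.not_injective true
    have hf := List.count_map_of_injective s (fun b => !b) Bool.not_injective false
    simp only [Bool.not_true, Bool.not_false] at ht hf
    rw [List.count_reverse, List.count_reverse, ht, hf, htotal]

theorem ht_reverse_map_not {s : List Bool} (hs : s.count false = s.count true) (k : ℕ) :
    ht (s.map (fun b => !b)).reverse k = ht s (s.length - k) := by
  have h_true := count_take_reverse_map_not s k true
  have h_false := count_take_reverse_map_not s k false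
  simp only [Bool.not_true, Bool.not_false] at h_true h_false
  unfold ht
  omega

theorem getD_reverse_of_lt {α : Type*} (l : List α) (d : α) {i : ℕ} (hi : i < l.length) :
    l.reverse.getD i d = l.getD (l.length - 1 - i) d := by
  rw [List.getD_eq_getElem _ _ (by simpa using hi), List.getD_eq_getElem _ _ (by omega),
    List.getElem_reverse]

theorem getD_reverse_map_not (s : List Bool) {i : ℕ} (hi : i < s.length) :
    (s.map (fun b => !b)).reverse.getD i false = !s.getD (s.length - 1 - i) false := by
  rw [getD_reverse_of_lt _ _ (by simpa using hi), List.length_map,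
    List.getD_eq_getElem _ _ (by rw [List.length_map]; omega),
    List.getD_eq_getElem _ _ (by omega), List.getElem_map]

theorem reflectWD_reflectWD (p : WDP) : reflectWD (reflectWD p) = p := by
  simp [reflectWD, List.map_reverse, Function.comp_def]

theorem isWD_reflectWD {n : ℕ} {p : WDP} (hp : IsWD n p) : IsWD n (reflectWD p) := by
  obtain ⟨hs, hw, hD, hlow, hup, hdown, hpeak, hvalley⟩ := hp
  have step {i : ℕ} (hi : i < 2 * n) :
      (reflectWD p).steps.getD i false = !p.steps.getD (2 * n - 1 - i) false := by
    rw [← hs] at hi ⊢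
    exact getD_reverse_map_not _ hi
  have weight {i : ℕ} (hi : i < 2 * n) :
      (reflectWD p).weights.getD i 0 = p.weights.getD (2 * n - 1 - i) 0 := by
    rw [← hw] at hi ⊢
    exact getD_reverse_of_lt _ _ hi
  have height (k : ℕ) : ht (reflectWD p).steps k = ht p.steps (2 * n - k) := by
    rw [← hs]
    exact ht_reverse_map_not hD.2 k
  -- The steps `i`, `i + 1` of the reflection come from the steps `j + 1`, `j` of `p`.
  have pair {i : ℕ} (hi : i + 1 < 2 * n) : ∃ j, j + 1 < 2 * n ∧
      2 * n - 1 - i = j + 1 ∧ 2 * n - 1 - (i + 1) = j ∧ 2 * n - (i + 1) = j + 1 :=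
    ⟨2 * n - 2 - i, by omega, by omega, by omega, by omega⟩
  refine ⟨by simpa [reflectWD] using hs, by simpa [reflectWD] using hw,
    hD.reverse_map_not, fun i hi => ?_, fun i hi h₁ h₂ => ?_, fun i hi h₁ h₂ => ?_,
    fun i hi h₁ h₂ => ?_, fun i hi h₁ h₂ => ?_⟩
  · have := hlow (2 * n - 1 - i) (by omega)
    rw [weight hi, height, height, min_comm, show 2 * n - 1 - i = 2 * n - (i + 1) by omega]
    rwa [show 2 * n - 1 - i + 1 = 2 * n - i by omega,
      show 2 * n - 1 - i = 2 * n - (i + 1) by omega] at this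
  all_goals
    obtain ⟨j, hj, e₁, e₂, e₃⟩ := pair hi
    rw [step (by omega), e₁] at h₁
    rw [step hi, e₂] at h₂
    simp only [Bool.not_eq_true', Bool.not_eq_false'] at h₁ h₂
    rw [weight (i := i) (by omega), weight hi, e₁, e₂]
  · exact hdown j hj h₂ h₁
  · exact hup j hj h₂ h₁
  · rw [height, e₃, add_comm]
    exact hpeak j hj h₂ h₁
  · rw [height, e₃, add_comm (p.weights.getD _ 0)]
    exact hvalley j hj h₂ h₁

/-- The reflection of a weighted Dyck path of `WD_{2n}` belongs to `WD_{2n}`,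
and reflection is an involution. -/
theorem reflectWD_mem_WD (n : ℕ) (hn : 1 ≤ n) (p : WDP) (hp : IsWD n p) :
    IsWD n (reflectWD p) ∧ reflectWD (reflectWD p) = p := by
  exact ⟨isWD_reflectWD hp, reflectWD_reflectWD p⟩
end

section
/- Let n be a positive integer and let σ be an up-down permutation of size 2n (i.e. σ_{2i−1} < σ_{2i} for 1 ≤ i ≤ n and σ_{2i} > σ_{2i+1} for 1 ≤ i ≤ n−1). Then σ avoids the pattern 1234 if and only if the following four conditions hold: (1) the word Top(σ) avoids the pattern 123; (2) the word Bot(σ) avoids the pattern 123; (3) every top element smaller than a bottom element k occurs to the right of k in σ (i.e. for all i, j, if σ_{2i} < σ_{2j−1} then 2i > 2j−1); (4) if a bottom element k = σ_{2j−1} has a smaller bottom element to its left (i.e. there is i < j with σ_{2i−1} < σ_{2j−1}), then all top elements greater than k occurring to the right of k appear in decreasing order in σ (i.e. for all a < b with j ≤ a, if σ_{2a} > k and σ_{2b} > k then σ_{2a} > σ_{2b}). -/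
/-- The `i`-th letter (1-based) of the word `w`. -/
def letter (w : List ℕ) (i : ℕ) : ℕ := w.getD (i - 1) 0

/-- `w` is a permutation word of size `N`, i.e. a rearrangement of `1, …, N`. -/
def IsPermWord (N : ℕ) (w : List ℕ) : Prop :=
  w.length = N ∧ ∀ k, k ∈ w ↔ k ∈ Finset.Icc 1 N

/-- `w` (of size `2n`) is up-down: `σ_{2i-1} < σ_{2i}` for `1 ≤ i ≤ n`
and `σ_{2i} > σ_{2i+1}` for `1 ≤ i ≤ n-1`. -/
def IsUpDown (n : ℕ) (w : List ℕ) : Prop :=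
  (∀ i, 1 ≤ i → i ≤ n → letter w (2 * i - 1) < letter w (2 * i)) ∧
  (∀ i, 1 ≤ i → i ≤ n - 1 → letter w (2 * i + 1) < letter w (2 * i))

/-- `w` avoids the pattern `1234`: no positions `p < q < r < s` with increasing letters. -/
def Avoids1234 (w : List ℕ) : Prop :=
  ¬∃ p q r s, 1 ≤ p ∧ p < q ∧ q < r ∧ r < s ∧ s ≤ w.length ∧
    letter w p < letter w q ∧ letter w q < letter w r ∧ letter w r < letter w s

/-- Membership in `A_{2n}(1234)`: an up-down permutation word of size `2n` avoiding `1234`. -/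
def IsA (n : ℕ) (w : List ℕ) : Prop :=
  IsPermWord (2 * n) w ∧ IsUpDown n w ∧ Avoids1234 w

theorem IsPermWord.nodup {N : ℕ} {w : List ℕ} (h : IsPermWord N w) : w.Nodup := by
  have hw : w.toFinset = Finset.Icc 1 N := by
    ext k
    rw [List.mem_toFinset, h.2]
  rw [← Multiset.coe_nodup, ← Multiset.toFinset_card_eq_card_iff_nodup]
  change w.toFinset.card = w.length
  rw [hw, h.1, Nat.card_Icc, Nat.add_sub_cancel]

theorem IsPermWord.letter_ne {N : ℕ} {w : List ℕ} (h : IsPermWord N w) {p q : ℕ}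
    (hp : 1 ≤ p) (hpq : p < q) (hq : q ≤ N) : letter w p ≠ letter w q := by
  have hlen := h.1
  have hp' : p - 1 < w.length := by omega
  have hq' : q - 1 < w.length := by omega
  intro heq
  rw [letter, letter, List.getD_eq_getElem _ _ hp', List.getD_eq_getElem _ _ hq',
    h.nodup.getElem_inj_iff] at heq
  omega

/-- Criteria for `1234`-avoidance of an up-down permutation (Borie):
an up-down permutation `σ` of size `2n` avoids `1234` iff
(1) `Top(σ)` avoids `123`; (2) `Bot(σ)` avoids `123`;
(3) every top element smaller than a bottom element occurs to its right;
(4) if a bottom element has a smaller bottom element to its left, then all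
larger top elements to its right appear in decreasing order. -/
theorem avoids1234_iff_criteria (n : ℕ) (hn : 1 ≤ n) (σ : List ℕ)
    (hperm : IsPermWord (2 * n) σ) (hud : IsUpDown n σ) :
    Avoids1234 σ ↔
      ((¬∃ i j k, 1 ≤ i ∧ i < j ∧ j < k ∧ k ≤ n ∧
          letter σ (2 * i) < letter σ (2 * j) ∧ letter σ (2 * j) < letter σ (2 * k)) ∧
       (¬∃ i j k, 1 ≤ i ∧ i < j ∧ j < k ∧ k ≤ n ∧
          letter σ (2 * i - 1) < letter σ (2 * j - 1) ∧
            letter σ (2 * j - 1) < letter σ (2 * k - 1)) ∧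
       (∀ i j, 1 ≤ i → i ≤ n → 1 ≤ j → j ≤ n →
          letter σ (2 * i) < letter σ (2 * j - 1) → 2 * j - 1 < 2 * i) ∧
       (∀ j, 1 ≤ j → j ≤ n →
          (∃ i, 1 ≤ i ∧ i < j ∧ letter σ (2 * i - 1) < letter σ (2 * j - 1)) →
          ∀ a b, j ≤ a → a < b → b ≤ n →
            letter σ (2 * j - 1) < letter σ (2 * a) →
            letter σ (2 * j - 1) < letter σ (2 * b) →
            letter σ (2 * b) < letter σ (2 * a))) := by
  obtain ⟨hup, -⟩ := hud
  have hlen := hperm.1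
  constructor
  · intro hav
    refine ⟨?_, ?_, ?_, ?_⟩
    · rintro ⟨i, j, k, hi, hij, hjk, hk, h₁, h₂⟩
      exact hav ⟨2 * i - 1, 2 * i, 2 * j, 2 * k, by omega, by omega, by omega, by omega, by omega,
        hup i hi (by omega), h₁, h₂⟩
    · rintro ⟨i, j, k, hi, hij, hjk, hk, h₁, h₂⟩
      exact hav ⟨2 * i - 1, 2 * j - 1, 2 * k - 1, 2 * k, by omega, by omega, by omega, by omega,
        by omega, h₁, h₂, hup k (by omega) hk⟩
    · intro i j hi hin hj hjn h
      by_contra hlt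
      exact hav ⟨2 * i - 1, 2 * i, 2 * j - 1, 2 * j, by omega, by omega, by omega, by omega,
        by omega, hup i hi hin, h, hup j hj hjn⟩
    · rintro j hj hjn ⟨i, hi, hij, h⟩ a b hja hab hbn ha -
      by_contra hlt
      have hne := hperm.letter_ne (p := 2 * a) (q := 2 * b) (by omega) (by omega) (by omega)
      exact hav ⟨2 * i - 1, 2 * j - 1, 2 * a, 2 * b, by omega, by omega, by omega, by omega,
        by omega, h, ha, by omega⟩
  · rintro ⟨htop, hbot, hright, hdec⟩ ⟨p, q, r, s, hp, hpq, hqr, hrs, hs, h₁, h₂, h₃⟩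
    have parity : ∀ x, 1 ≤ x → ∃ i, 1 ≤ i ∧ (x = 2 * i - 1 ∨ x = 2 * i) := fun x hx =>
      ⟨(x + 1) / 2, by omega, by omega⟩
    have no_top_bot : ∀ i j, 1 ≤ i → 2 * i < 2 * j - 1 → j ≤ n →
        ¬letter σ (2 * i) < letter σ (2 * j - 1) := fun i j hi hij hj h => by
      have := hright i j hi (by omega) (by omega) hj h
      omega
    obtain ⟨b, hb, rfl | rfl⟩ := parity q (by omega) <;>
      obtain ⟨c, hc, rfl | rfl⟩ := parity r (by omega)
    · obtain ⟨a, ha, rfl | rfl⟩ := parity p hp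
      · exact hbot ⟨a, b, c, ha, by omega, by omega, by omega, h₁, h₂⟩
      · exact no_top_bot a b ha hpq (by omega) h₁
    · obtain ⟨a, ha, rfl | rfl⟩ := parity p hp
      · obtain ⟨d, hd, rfl | rfl⟩ := parity s (by omega)
        · exact no_top_bot c d hc hrs (by omega) h₃
        · have := hdec b hb (by omega) ⟨a, ha, by omega, h₁⟩ c d (by omega) (by omega)
            (by omega) h₂ (h₂.trans h₃)
          omega
      · exact no_top_bot a b ha hpq (by omega) h₁
    · exact no_top_bot b c hb hqr (by omega) h₂
    · obtain ⟨d, hd, rfl | rfl⟩ := parity s (by omega)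
      · exact no_top_bot c d hc hrs (by omega) h₃
      · exact htop ⟨b, c, d, hb, by omega, by omega, by omega, h₂, h₃⟩
end

section
/- Let σ be an up-down permutation of size 2n avoiding 1234 and suppose a bottom element σ_{2j−1} has a smaller bottom element to its left, i.e. there exists i < j with σ_{2i−1} < σ_{2j−1}. Then all top elements greater than σ_{2j−1} lying to its right appear in decreasing order: for all a, b with j ≤ a < b ≤ n, if σ_{2a} > σ_{2j−1} and σ_{2b} > σ_{2j−1}, then σ_{2a} > σ_{2b}. -/
/-- In a `1234`-avoiding up-down permutation of size `2n`, if a bottom element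
`σ_{2j-1}` has a smaller bottom element to its left, then all top elements
greater than `σ_{2j-1}` lying to its right appear in decreasing order. -/
theorem tops_decreasing_right_of_bottom (n : ℕ) (hn : 1 ≤ n) (σ : List ℕ)
    (hσ : IsA n σ) (j : ℕ) (hj1 : 1 ≤ j) (hjn : j ≤ n)
    (hleft : ∃ i, 1 ≤ i ∧ i < j ∧ letter σ (2 * i - 1) < letter σ (2 * j - 1)) :
    ∀ a b, j ≤ a → a < b → b ≤ n →
      letter σ (2 * j - 1) < letter σ (2 * a) →
      letter σ (2 * j - 1) < letter σ (2 * b) →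
      letter σ (2 * b) < letter σ (2 * a) := by
  obtain ⟨i, hi, hij, hlt⟩ := hleft
  obtain ⟨hperm, -, havoid⟩ := hσ
  intro a b hja hab hbn ha _
  by_contra hnot
  have hne := hperm.letter_ne (p := 2 * a) (q := 2 * b) (by omega) (by omega) (by omega)
  have hlen := hperm.1
  exact havoid ⟨2 * i - 1, 2 * j - 1, 2 * a, 2 * b, by omega, by omega, by omega, by omega,
    by omega, hlt, ha, by omega⟩
end

section
/- For every positive integer n there exists a bijection β from the set WD_{2n} of weighted Dyck paths of length 2n onto the set A_{2n}(1234) of up-down permutations of size 2n avoiding 1234, such that for every wd ∈ WD_{2n}, the set of positions (in {1,…,2n}) of the up-steps of wd equals the set of bottom elements of β(wd), i.e. the set {β(wd)_1, β(wd)_3, …, β(wd)_{2n−1}} of values at odd positions. -/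
/-- A sequence of `N` columns; the `i`-th column carries a bottom entry `b i` and a top entry
`t i`, and both functions are meant to vanish from `N` on. -/
@[ext]
structure Columns where
  N : ℕ
  b : ℕ → ℕ
  t : ℕ → ℕ

namespace Columns

/-- Insert the value `x` at index `p` of the sequence `f`. -/
def insertAt (p x : ℕ) (f : ℕ → ℕ) (i : ℕ) : ℕ :=
  if i < p then f i else if i = p then x else f (i - 1)

/-- Remove the entry at index `p` of the sequence `f`. -/
def removeAt (p : ℕ) (f : ℕ → ℕ) (i : ℕ) : ℕ := if i < p then f i else f (i + 1)

/-- The columns obtained from an up-down word avoiding `1234` by keeping only the values at most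
`u`: columns with a larger bottom are deleted, and larger tops are replaced by `K`. -/
structure Valid (K u : ℕ) (C : Columns) : Prop where
  b_pos : ∀ i < C.N, 1 ≤ C.b i
  b_le : ∀ i < C.N, C.b i ≤ u
  b_lt_t : ∀ i < C.N, C.b i < C.t i
  t_le : ∀ i < C.N, C.t i ≤ u ∨ C.t i = K
  junk : ∀ i, C.N ≤ i → C.b i = 0 ∧ C.t i = 0
  b_inj : ∀ i j, i < j → j < C.N → C.b i ≠ C.b j
  t_inj : ∀ i j, i < j → j < C.N → C.t i = C.t j → C.t i = K
  b_ne_t : ∀ i j, i < C.N → j < C.N → C.b i ≠ C.t j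
  surj : ∀ v, 1 ≤ v → v ≤ u → ∃ i < C.N, C.b i = v ∨ C.t i = v
  lt_tb : ∀ i j, i < j → j < C.N → C.b j < C.t i
  no_bbb : ∀ i j k, i < j → j < k → k < C.N → C.b i < C.b j → C.b k ≤ C.b j
  no_ttt : ∀ i j k, i < j → j < k → k < C.N → C.t i < C.t j → C.t k ≤ C.t j
  no_bbtt : ∀ i j k l, i < j → j ≤ k → k < l → l < C.N → C.b i < C.b j → C.b j < C.t k →
    C.t l ≤ C.t k

/-- `m` is the length of the longest initial segment of columns whose tops all equal `K` and
whose bottoms are decreasing. -/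
structure IsRun (K : ℕ) (C : Columns) (m : ℕ) : Prop where
  le : m ≤ C.N
  open_top : ∀ i < m, C.t i = K
  decr : ∀ i j, i < j → j < m → C.b j < C.b i
  maximal : m < C.N → C.t m = K → ∃ i < m, C.b i < C.b m

theorem IsRun.unique {K : ℕ} {C : Columns} {m m' : ℕ} (h : IsRun K C m) (h' : IsRun K C m') :
    m = m' := by
  have key : ∀ {a c : ℕ}, IsRun K C a → IsRun K C c → ¬ a < c := by
    intro a c ha hc hac
    obtain ⟨i, hi, hlt⟩ := ha.maximal (lt_of_lt_of_le hac hc.le) (hc.open_top a hac)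
    have := hc.decr i a hi hac
    omega
  have h1 := key h h'
  have h2 := key h' h
  omega

/-- The number of columns with top `K`. -/
def openCount (K : ℕ) (C : Columns) : ℕ := ((Finset.range C.N).filter (fun i => C.t i = K)).card

/-- Insert at index `p` a column with bottom `v` and top `K`. -/
def addBottom (K v p : ℕ) (C : Columns) : Columns :=
  ⟨C.N + 1, insertAt p v C.b, insertAt p K C.t⟩

/-- Replace the top of column `q` by `v`. -/
def setTop (v q : ℕ) (C : Columns) : Columns := ⟨C.N, C.b, Function.update C.t q v⟩

/-- Remove the column `p`. -/
def dropColumn (p : ℕ) (C : Columns) : Columns :=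
  ⟨C.N - 1, removeAt p C.b, removeAt p C.t⟩

theorem removeAt_insertAt (p x : ℕ) (f : ℕ → ℕ) : removeAt p (insertAt p x f) = f := by
  funext i
  unfold removeAt insertAt
  grind

theorem insertAt_removeAt (p : ℕ) (f : ℕ → ℕ) : insertAt p (f p) (removeAt p f) = f := by
  funext i
  unfold removeAt insertAt
  grind

theorem dropColumn_addBottom (K v p : ℕ) (C : Columns) :
    dropColumn p (addBottom K v p C) = C := by
  simp [dropColumn, addBottom, removeAt_insertAt]

theorem addBottom_valid {K u p : ℕ} {C : Columns} (hK : u + 1 < K) (hC : Valid K u C) (hp : p ≤ C.N)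
    (hopen : ∀ i < p, C.t i = K) (hdecr : ∀ i j, i < j → j < p → C.b j < C.b i) :
    Valid K (u + 1) (addBottom K (u + 1) p C) := by
  obtain ⟨h1, h2, h3, h4, h5, h6, h7, h8, h9, h10, h11, h12, h13⟩ := hC
  have hle : ∀ i < C.N, C.t i ≤ K := fun i hi => by have := h4 i hi; omega
  constructor <;> simp only [addBottom, insertAt]
  · intro i hi
    have := h1 i
    have := h1 (i - 1)
    split_ifs <;> omega
  · intro i hi
    have := h2 i
    have := h2 (i - 1)
    split_ifs <;> omega
  · intro i hi
    have := h3 i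
    have := h3 (i - 1)
    split_ifs <;> omega
  · intro i hi
    have := h4 i
    have := h4 (i - 1)
    split_ifs <;> omega
  · intro i hi
    rw [if_neg (by omega), if_neg (by omega), if_neg (by omega), if_neg (by omega)]
    exact h5 (i - 1) (by omega)
  · intro i j hij hj
    have := h2 i
    have := h2 (i - 1)
    have := h2 j
    have := h2 (j - 1)
    have := h6 i j
    have := h6 i (j - 1)
    have := h6 (i - 1) (j - 1)
    split_ifs <;> omega
  · intro i j hij hj
    have := hopen i
    have := h7 i j
    have := h7 i (j - 1)
    have := h7 (i - 1) (j - 1)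
    split_ifs <;> omega
  · intro i j hi hj
    have := h2 i
    have := h2 (i - 1)
    have := h4 j
    have := h4 (j - 1)
    have := h8 i j
    have := h8 i (j - 1)
    have := h8 (i - 1) j
    have := h8 (i - 1) (j - 1)
    split_ifs <;> omega
  · intro v hv1 hv2
    by_cases hv : v = u + 1
    · exact ⟨p, by omega, by simp [hv]⟩
    · obtain ⟨i, hi, h⟩ := h9 v hv1 (by omega)
      by_cases hip : i < p
      · exact ⟨i, by omega, by simpa [hip] using h⟩
      · refine ⟨i + 1, by omega, ?_⟩
        rwa [if_neg (by omega), if_neg (by omega), if_neg (by omega), if_neg (by omega),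
          Nat.add_sub_cancel]
  · intro i j hij hj
    have := hopen i
    have := h2 j
    have := h2 (j - 1)
    have := h10 i j
    have := h10 i (j - 1)
    have := h10 (i - 1) (j - 1)
    split_ifs <;> omega
  · intro i j k hij hjk hk
    have := h2 (j - 1)
    have := h2 (k - 1)
    have := hdecr i j hij
    have := h11 i j k hij hjk
    have := h11 i j (k - 1) hij
    have := h11 i (j - 1) (k - 1)
    have := h11 (i - 1) (j - 1) (k - 1)
    split_ifs <;> omega
  · intro i j k hij hjk hk
    have := hopen i
    have := hopen j
    have := hle (j - 1)
    have := hle (k - 1)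
    have := h12 i j k hij hjk
    have := h12 i j (k - 1) hij
    have := h12 i (j - 1) (k - 1)
    have := h12 (i - 1) (j - 1) (k - 1)
    split_ifs <;> omega
  · intro i j k l hij hjk hkl hl
    have := hopen k
    have := h2 (j - 1)
    have := h4 (k - 1)
    have := hle (l - 1)
    split_ifs <;> first
      | omega
      | exact h13 i j k l hij hjk hkl (by omega)
      | exact h13 i j (k - 1) (l - 1) hij (by omega) (by omega) (by omega)
      | exact h13 i (j - 1) (k - 1) (l - 1) (by omega) (by omega) (by omega) (by omega)
      | exact h13 (i - 1) (j - 1) (k - 1) (l - 1) (by omega) (by omega) (by omega) (by omega)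

theorem dropColumn_valid {K u p : ℕ} {C : Columns} (hC : Valid K (u + 1) C)
    (hp : p < C.N) (hb : C.b p = u + 1) : Valid K u (dropColumn p C) := by
  obtain ⟨h1, h2, h3, h4, h5, h6, h7, h8, h9, h10, h11, h12, h13⟩ := hC
  have hbu : ∀ i < C.N, i ≠ p → C.b i ≤ u := by
    intro i hi hne
    have := h2 i hi
    have := h6 i p
    have := h6 p i
    omega
  have htu : ∀ i < C.N, C.t i ≤ u ∨ C.t i = K := by
    intro i hi
    have := h4 i hi
    have := h8 p i hp hi
    omega
  constructor <;> simp only [dropColumn, removeAt]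
  · intro i hi
    have := h1 i
    have := h1 (i + 1)
    split_ifs <;> omega
  · intro i hi
    have := hbu i
    have := hbu (i + 1)
    split_ifs <;> omega
  · intro i hi
    have := h3 i
    have := h3 (i + 1)
    split_ifs <;> omega
  · intro i hi
    have := htu i
    have := htu (i + 1)
    split_ifs <;> omega
  · intro i hi
    have := h5 (i + 1) (by omega)
    split_ifs <;> omega
  · intro i j hij hj
    have := h6 i j
    have := h6 i (j + 1)
    have := h6 (i + 1) (j + 1)
    split_ifs <;> omega
  · intro i j hij hj
    have := h7 i j
    have := h7 i (j + 1)
    have := h7 (i + 1) (j + 1)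
    split_ifs <;> omega
  · intro i j hi hj
    have := h8 i j
    have := h8 i (j + 1)
    have := h8 (i + 1) j
    have := h8 (i + 1) (j + 1)
    split_ifs <;> omega
  · intro v hv1 hv2
    obtain ⟨i, hi, h⟩ := h9 v hv1 (by omega)
    have hne : i ≠ p := by
      rintro rfl
      have := h3 i hi
      omega
    by_cases hip : i < p
    · exact ⟨i, by omega, by simpa [hip] using h⟩
    · refine ⟨i - 1, by omega, ?_⟩
      rwa [if_neg (by omega), if_neg (by omega), Nat.sub_add_cancel (by omega)]
  · intro i j hij hj
    have := h10 i j
    have := h10 i (j + 1)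
    have := h10 (i + 1) (j + 1)
    split_ifs <;> omega
  · intro i j k hij hjk hk
    have := h11 i j k hij hjk
    have := h11 i j (k + 1) hij
    have := h11 i (j + 1) (k + 1)
    have := h11 (i + 1) (j + 1) (k + 1)
    split_ifs <;> omega
  · intro i j k hij hjk hk
    have := h12 i j k hij hjk
    have := h12 i j (k + 1) hij
    have := h12 i (j + 1) (k + 1)
    have := h12 (i + 1) (j + 1) (k + 1)
    split_ifs <;> omega
  · intro i j k l hij hjk hkl hl
    split_ifs <;> first
      | omega
      | exact h13 i j k l hij hjk hkl (by omega)
      | exact h13 i j k (l + 1) hij hjk (by omega) (by omega)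
      | exact h13 i j (k + 1) (l + 1) hij (by omega) (by omega) (by omega)
      | exact h13 i (j + 1) (k + 1) (l + 1) (by omega) (by omega) (by omega) (by omega)
      | exact h13 (i + 1) (j + 1) (k + 1) (l + 1) (by omega) (by omega) (by omega) (by omega)

theorem setTop_valid {K u q : ℕ} {C : Columns} (hK : u + 1 < K) (hC : Valid K u C) (hq : q < C.N)
    (hqK : C.t q = K)
    (hlast : (∀ i, q < i → i < C.N → C.t i ≠ K) ∨
      ((∀ i < q, C.t i = K) ∧ ∀ i j, i < j → j ≤ q → C.b j < C.b i)) :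
    Valid K (u + 1) (setTop (u + 1) q C) := by
  obtain ⟨h1, h2, h3, h4, h5, h6, h7, h8, h9, h10, h11, h12, h13⟩ := hC
  have hle : ∀ i < C.N, C.t i ≤ K := fun i hi => by have := h4 i hi; omega
  have hset : ∀ i, i = q ∧ Function.update C.t q (u + 1) i = u + 1 ∧ C.t i = K ∨
      i ≠ q ∧ Function.update C.t q (u + 1) i = C.t i := by
    intro i
    by_cases h : i = q
    · simp [h, hqK]
    · simp [h]
  constructor <;> simp only [setTop]
  · exact h1
  · intro i hi
    have := h2 i hi
    omega
  · intro i hi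
    have := h2 i hi
    have := h3 i hi
    have := hset i
    omega
  · intro i hi
    have := h4 i hi
    have := hset i
    omega
  · intro i hi
    have := h5 i hi
    have := hset i
    omega
  · exact h6
  · intro i j hij hj
    have := h7 i j hij hj
    have := h4 i (by omega)
    have := h4 j hj
    have := hset i
    have := hset j
    omega
  · intro i j hi hj
    have := h2 i hi
    have := h8 i j hi hj
    have := hset j
    omega
  · intro v hv1 hv2
    by_cases hv : v = u + 1
    · exact ⟨q, by omega, by simp [hv]⟩
    · obtain ⟨i, hi, h⟩ := h9 v hv1 (by omega)
      have := hset i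
      exact ⟨i, hi, by omega⟩
  · intro i j hij hj
    have := h2 j hj
    have := h10 i j hij hj
    have := hset i
    omega
  · exact h11
  · intro i j k hij hjk hk
    have := h12 i j k hij hjk hk
    have := h4 i (by omega)
    have := h4 j (by omega)
    have := h4 k hk
    have := hset i
    have := hset j
    have := hset k
    rcases hlast with hlast | ⟨hlast, -⟩
    · have := hlast k
      omega
    · have := hlast i
      have := hlast j
      omega
  · intro i j k l hij hjk hkl hl
    have := h13 i j k l hij hjk hkl hl
    have := h4 k (by omega)
    have := h4 l hl
    have := hset k
    have := hset l
    rcases hlast with hlast | ⟨hlast, hdecr⟩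
    · have := hlast l
      omega
    · have := hlast k
      have := hdecr i j hij
      omega

theorem setTop_open_valid {K u q : ℕ} {C : Columns} (hK : u + 1 < K) (hC : Valid K (u + 1) C)
    (hq : q < C.N) (ht : C.t q = u + 1) : Valid K u (setTop K q C) := by
  obtain ⟨h1, h2, h3, h4, h5, h6, h7, h8, h9, h10, h11, h12, h13⟩ := hC
  have hbu : ∀ i < C.N, C.b i ≤ u := by
    intro i hi
    have := h2 i hi
    have := h8 i q hi hq
    omega
  have htu : ∀ i < C.N, i ≠ q → C.t i ≤ u ∨ C.t i = K := by
    intro i hi hne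
    have := h4 i hi
    have := h7 i q
    have := h7 q i
    omega
  have hset : ∀ i, i = q ∧ Function.update C.t q K i = K ∧ C.t i = u + 1 ∨
      i ≠ q ∧ Function.update C.t q K i = C.t i := by
    intro i
    by_cases h : i = q
    · simp [h, ht]
    · simp [h]
  constructor <;> simp only [setTop]
  · exact h1
  · exact hbu
  · intro i hi
    have := h3 i hi
    have := hset i
    omega
  · intro i hi
    have := htu i hi
    have := hset i
    omega
  · intro i hi
    have := h5 i hi
    have := hset i
    omega
  · exact h6
  · intro i j hij hj
    have := h7 i j hij hj
    have := hset i
    have := hset j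
    omega
  · intro i j hi hj
    have := hbu i hi
    have := h8 i j hi hj
    have := hset j
    omega
  · intro v hv1 hv2
    obtain ⟨i, hi, h⟩ := h9 v hv1 (by omega)
    have := hset i
    exact ⟨i, hi, by omega⟩
  · intro i j hij hj
    have := hbu j hj
    have := h10 i j hij hj
    have := hset i
    omega
  · exact h11
  · intro i j k hij hjk hk
    have := h12 i j k hij hjk hk
    have := htu j (by omega)
    have := htu k hk
    have := hset i
    have := hset j
    have := hset k
    omega
  · intro i j k l hij hjk hkl hl
    have := h13 i j k l hij hjk hkl hl
    have := htu k (by omega)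
    have := htu l hl
    have := hset k
    have := hset l
    omega

theorem addBottom_isRun_zero {K u m : ℕ} {C : Columns} (hC : Valid K u C) (hm : IsRun K C m) :
    IsRun K (addBottom K (u + 1) 0 C) (m + 1) := by
  obtain ⟨h1, h2, h3, h4⟩ := hm
  have := hC.b_le
  constructor <;> simp only [addBottom, insertAt]
  · omega
  · grind
  · intro i j hij hj
    have := this (j - 1)
    have := h3 (i - 1) (j - 1)
    split_ifs <;> omega
  · intro hlt ht
    obtain ⟨i, hi, h⟩ := h4 (by omega) (by simpa using ht)
    exact ⟨i + 1, by omega, by simpa using h⟩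

theorem addBottom_isRun_pos {K u m p : ℕ} {C : Columns} (hC : Valid K u C) (hm : IsRun K C m)
    (hp : 1 ≤ p) (hpm : p ≤ m) : IsRun K (addBottom K (u + 1) p C) p := by
  obtain ⟨h1, h2, h3, h4⟩ := hm
  have := hC.b_le
  constructor <;> simp only [addBottom, insertAt]
  · omega
  · grind
  · grind
  · exact fun _ _ => ⟨0, by omega, by grind⟩

theorem setTop_isRun_of_lt {K v m q : ℕ} {C : Columns} (hv : v ≠ K) (hm : IsRun K C m)
    (hq : q < m) : IsRun K (setTop v q C) q := by
  obtain ⟨h1, h2, h3, h4⟩ := hm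
  constructor <;> simp only [setTop, Function.update_apply] <;> grind

theorem setTop_isRun_of_le {K v m q : ℕ} {C : Columns} (hv : v ≠ K) (hm : IsRun K C m)
    (hq : m ≤ q) : IsRun K (setTop v q C) m := by
  obtain ⟨h1, h2, h3, h4⟩ := hm
  constructor <;> simp only [setTop, Function.update_apply] <;> grind

theorem openCount_addBottom {K v p : ℕ} {C : Columns} (hp : p ≤ C.N) :
    openCount K (addBottom K v p C) = openCount K C + 1 := by
  have hinj : Function.Injective (fun i => if i < p then i else i + 1) := by
    intro i j
    grind
  have : (Finset.range (C.N + 1)).filter (fun i => insertAt p K C.t i = K) =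
      insert p (((Finset.range C.N).filter (fun i => C.t i = K)).image
        (fun i => if i < p then i else i + 1)) := by
    ext i
    simp only [Finset.mem_filter, Finset.mem_range, Finset.mem_insert, Finset.mem_image]
    simp only [insertAt]
    constructor
    · rintro ⟨hi, h⟩
      rcases lt_trichotomy i p with hip | hip | hip
      · exact Or.inr ⟨i, by grind, by grind⟩
      · exact Or.inl hip
      · exact Or.inr ⟨i - 1, by grind, by grind⟩
    · rintro (rfl | ⟨j, ⟨hj, h⟩, rfl⟩)
      · simp [hp]
      · grind
  unfold openCount addBottom
  simp only
  rw [this, Finset.card_insert_of_notMem, Finset.card_image_of_injective _ hinj]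
  simp only [Finset.mem_image, not_exists, not_and]
  grind

theorem openCount_setTop {K v q : ℕ} {C : Columns} (hv : v ≠ K) (hq : q < C.N) (hqK : C.t q = K) :
    openCount K (setTop v q C) = openCount K C - 1 := by
  have : (Finset.range C.N).filter (fun i => Function.update C.t q v i = K) =
      ((Finset.range C.N).filter (fun i => C.t i = K)).erase q := by
    ext i
    simp only [Finset.mem_filter, Finset.mem_range, Finset.mem_erase, Function.update_apply]
    grind
  unfold openCount setTop
  simp only
  rw [this, Finset.card_erase_of_mem (by simp [hq, hqK])]

theorem exists_open_of_lt {K m : ℕ} {C : Columns} (h : m < openCount K C) :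
    ∃ i, m ≤ i ∧ i < C.N ∧ C.t i = K := by
  by_contra! hcon
  have : (Finset.range C.N).filter (fun i => C.t i = K) ⊆ Finset.range m := by
    intro i
    simp only [Finset.mem_filter, Finset.mem_range]
    grind
  have := Finset.card_le_card this
  rw [Finset.card_range] at this
  unfold openCount at h
  omega

theorem lt_openCount {K m q : ℕ} {C : Columns} (hm : IsRun K C m) (hmq : m ≤ q) (hq : q < C.N)
    (hqK : C.t q = K) : m < openCount K C := by
  have : insert q (Finset.range m) ⊆ (Finset.range C.N).filter (fun i => C.t i = K) := by
    intro i
    have := hm.le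
    have := hm.open_top
    simp only [Finset.mem_insert, Finset.mem_filter, Finset.mem_range]
    grind
  have := Finset.card_le_card this
  rw [Finset.card_insert_of_notMem (by simpa using hmq), Finset.card_range] at this
  exact this

/-- The index of the last column with top `K`. -/
def lastOpen (K : ℕ) (C : Columns) : ℕ := Nat.findGreatest (fun i => C.t i = K) C.N

/-- Where the next bottom goes if the run length changes from `m` to `m'`. -/
def bottomIndex (m m' : ℕ) : ℕ := if m' = m + 1 then 0 else m'

/-- Where the next top goes if the run length changes from `m` to `m'`. -/
def topIndex (K m m' : ℕ) (C : Columns) : ℕ := if m' < m then m' else lastOpen K C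

/-- The columns after the first `u` values, placed according to the steps `s` and the prescribed
run lengths `M`. -/
def build (K : ℕ) (s : ℕ → Bool) (M : ℕ → ℕ) : ℕ → Columns
  | 0 => ⟨0, fun _ => 0, fun _ => 0⟩
  | u + 1 =>
    if s u = true then
      addBottom K (u + 1) (bottomIndex (M u) (M (u + 1))) (build K s M u)
    else
      setTop (u + 1) (topIndex K (M u) (M (u + 1)) (build K s M u)) (build K s M u)

/-- The height after `u` steps of the path with steps `s`. -/
def height (s : ℕ → Bool) : ℕ → ℕ
  | 0 => 0
  | u + 1 => if s u = true then height s u + 1 else height s u - 1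

/-- `M` is an admissible sequence of run lengths for the first `u` steps `s`. -/
def Admissible (s : ℕ → Bool) (M : ℕ → ℕ) (u : ℕ) : Prop :=
  M 0 = 0 ∧ ∀ i < u, (s i = true → 1 ≤ M (i + 1) ∧ M (i + 1) ≤ M i + 1) ∧
    (s i = false → M (i + 1) ≤ M i ∧ M (i + 1) < height s i)

theorem Admissible.mono {s : ℕ → Bool} {M : ℕ → ℕ} {u v : ℕ} (h : Admissible s M v) (huv : u ≤ v) :
    Admissible s M u := ⟨h.1, fun i hi => h.2 i (by omega)⟩

theorem Admissible.le_height {s : ℕ → Bool} {M : ℕ → ℕ} {u : ℕ} (h : Admissible s M u) :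
    M u ≤ height s u := by
  induction u with
  | zero => simp [h.1]
  | succ u ih =>
    have := ih (h.mono (by omega))
    have := h.2 u (by omega)
    unfold height
    cases hs : s u <;> simp_all <;> omega

theorem lastOpen_spec {K u i : ℕ} {C : Columns} (hK : 0 < K) (hC : Valid K u C) (hi : i < C.N)
    (hiK : C.t i = K) : i ≤ lastOpen K C ∧ lastOpen K C < C.N ∧ C.t (lastOpen K C) = K ∧
      ∀ j, lastOpen K C < j → j < C.N → C.t j ≠ K := by
  have h1 : i ≤ lastOpen K C := Nat.le_findGreatest hi.le hiK
  have h2 : C.t (lastOpen K C) = K :=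
    Nat.findGreatest_spec (P := fun i => C.t i = K) hi.le hiK
  refine ⟨h1, ?_, h2, fun j hj hjN hjK => ?_⟩
  · by_contra hcon
    have := (hC.junk _ (not_lt.mp hcon)).2
    omega
  · have : j ≤ lastOpen K C := Nat.le_findGreatest hjN.le hjK
    omega

theorem topIndex_spec {K u m m' : ℕ} {C : Columns} (hK : 0 < K) (hC : Valid K u C)
    (hm : IsRun K C m) (h1 : m' ≤ m) (h2 : m' < openCount K C) :
    topIndex K m m' C < C.N ∧ C.t (topIndex K m m' C) = K ∧
    ((∀ i, topIndex K m m' C < i → i < C.N → C.t i ≠ K) ∨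
      ((∀ i < topIndex K m m' C, C.t i = K) ∧
        ∀ i j, i < j → j ≤ topIndex K m m' C → C.b j < C.b i)) ∧
    (m' < m ∧ topIndex K m m' C = m' ∨ m' = m ∧ m ≤ topIndex K m m' C) := by
  obtain ⟨a1, a2, a3, a4⟩ := hm
  unfold topIndex
  split_ifs with h
  · refine ⟨by omega, a2 _ h, Or.inr ⟨fun i hi => a2 _ (by omega), fun i j hij hj =>
      a3 _ _ hij (by omega)⟩, Or.inl ⟨h, rfl⟩⟩
  · obtain ⟨i, hmi, hi, hiK⟩ := exists_open_of_lt h2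
    obtain ⟨c1, c2, c3, c4⟩ := lastOpen_spec hK hC hi hiK
    exact ⟨c2, c3, Or.inl c4, Or.inr ⟨by omega, by omega⟩⟩

theorem bottomIndex_le {m m' : ℕ} (h : m' ≤ m + 1) : bottomIndex m m' ≤ m := by
  unfold bottomIndex
  split_ifs <;> omega

theorem build_spec {K : ℕ} {s : ℕ → Bool} {M : ℕ → ℕ} {u : ℕ} (hu : u < K)
    (h : Admissible s M u) :
    Valid K u (build K s M u) ∧ IsRun K (build K s M u) (M u) ∧
      openCount K (build K s M u) = height s u := by
  induction u with
  | zero =>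
    refine ⟨?_, ?_, ?_⟩
    · constructor <;> simp [build]; omega
    · rw [h.1]
      constructor <;> simp [build]
    · rfl
  | succ u ih =>
    obtain ⟨hV, hR, hO⟩ := ih (by omega) (h.mono (by omega))
    obtain ⟨hup, hdown⟩ := h.2 u (by omega)
    unfold build height
    cases hs : s u
    · obtain ⟨h1, h2⟩ := hdown hs
      rw [← hO] at h2
      obtain ⟨c1, c2, c3, c4⟩ := topIndex_spec (by omega) hV hR h1 h2
      simp only [Bool.false_eq_true, if_false]
      refine ⟨setTop_valid hu hV c1 c2 c3, ?_, ?_⟩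
      · rcases c4 with ⟨d1, d2⟩ | ⟨d1, d2⟩
        · rw [d2]
          exact setTop_isRun_of_lt (by omega) hR d1
        · rw [d1] at d2 ⊢
          exact setTop_isRun_of_le (by omega) hR d2
      · rw [openCount_setTop (by omega) c1 c2, hO]
    · obtain ⟨h1, h2⟩ := hup hs
      have hle := bottomIndex_le h2
      simp only [if_true]
      refine ⟨addBottom_valid hu hV (hle.trans hR.le) (fun i hi => hR.open_top i (by omega))
        (fun i j hij hj => hR.decr i j hij (by omega)), ?_, ?_⟩
      · unfold bottomIndex
        split_ifs with heq
        · rw [heq]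
          exact addBottom_isRun_zero hV hR
        · exact addBottom_isRun_pos hV hR h1 (by omega)
      · rw [openCount_addBottom (hle.trans hR.le), hO]

theorem build_congr {K : ℕ} {s s' : ℕ → Bool} {M M' : ℕ → ℕ} {u : ℕ} (hs : ∀ i < u, s i = s' i)
    (hM : ∀ i ≤ u, M i = M' i) : build K s M u = build K s' M' u := by
  induction u with
  | zero => rfl
  | succ u ih =>
    unfold build
    rw [ih (fun i hi => hs i (by omega)) (fun i hi => hM i (by omega)), hs u (by omega),
      hM u (by omega), hM (u + 1) (by omega)]

theorem height_congr {s s' : ℕ → Bool} {u : ℕ} (hs : ∀ i < u, s i = s' i) :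
    height s u = height s' u := by
  induction u with
  | zero => rfl
  | succ u ih =>
    unfold height
    rw [ih (fun i hi => hs i (by omega)), hs u (by omega)]

theorem Admissible.congr {s s' : ℕ → Bool} {M M' : ℕ → ℕ} {u : ℕ} (h : Admissible s M u)
    (hs : ∀ i < u, s i = s' i) (hM : ∀ i ≤ u, M i = M' i) : Admissible s' M' u := by
  refine ⟨by rw [← hM 0 (by omega), h.1], fun i hi => ?_⟩
  rw [← hs i hi, ← hM i (by omega), ← hM (i + 1) (by omega),
    ← height_congr (s := s) (fun j hj => hs j (by omega))]
  exact h.2 i hi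

theorem exists_build {K u : ℕ} {C : Columns} (hu : u < K) (hC : Valid K u C) :
    ∃ s M, Admissible s M u ∧ build K s M u = C := by
  induction u generalizing C with
  | zero =>
    have hN : C.N = 0 := by
      by_contra h
      have h1 := hC.b_pos 0 (by omega)
      have h2 := hC.b_le 0 (by omega)
      omega
    refine ⟨fun _ => true, fun _ => 0, ⟨rfl, by simp⟩, ?_⟩
    ext i
    · exact hN.symm
    · exact (hC.junk i (by omega)).1.symm
    · exact (hC.junk i (by omega)).2.symm
  | succ u ih =>
    have extend : ∀ (s : ℕ → Bool) (M : ℕ → ℕ) (c : Bool) (m' : ℕ), Admissible s M u →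
        ((c = true → 1 ≤ m' ∧ m' ≤ M u + 1) ∧ (c = false → m' ≤ M u ∧ m' < height s u)) →
        (if c = true then addBottom K (u + 1) (bottomIndex (M u) m') (build K s M u) else
          setTop (u + 1) (topIndex K (M u) m' (build K s M u)) (build K s M u)) = C →
        ∃ s M, Admissible s M (u + 1) ∧ build K s M (u + 1) = C := by
      intro s M c m' hA hm' hCeq
      have hs' : ∀ i < u, s i = Function.update s u c i := by
        intro i hi
        rw [Function.update_of_ne (by omega)]
      have hM' : ∀ i ≤ u, M i = Function.update M (u + 1) m' i := by
        intro i hi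
        rw [Function.update_of_ne (by omega)]
      refine ⟨Function.update s u c, Function.update M (u + 1) m',
        ⟨(hA.congr hs' hM').1, fun i hi => ?_⟩, ?_⟩
      · by_cases hiu : i = u
        · subst hiu
          rw [← hM' i le_rfl, ← height_congr hs']
          simpa using hm'
        · exact (hA.congr hs' hM').2 i (by omega)
      · rw [← hCeq, build, ← build_congr hs' hM', ← hM' u le_rfl]
        simp
    obtain ⟨p, hp, hpv⟩ := hC.surj (u + 1) (by omega) le_rfl
    rcases hpv with hb | ht
    · obtain ⟨s, M, hA, hB⟩ := ih (by omega) (dropColumn_valid hC hp hb)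
      have hR := (build_spec (by omega : u < K) hA).2.1
      have htp : C.t p = K := by
        have := hC.b_lt_t p hp
        have := hC.t_le p hp
        omega
      have hCeq : addBottom K (u + 1) p (build K s M u) = C := by
        rw [hB]
        simp only [addBottom, dropColumn]
        rw [← htp, ← hb, insertAt_removeAt, insertAt_removeAt, Nat.sub_add_cancel (by omega)]
      rw [hB] at hR
      have hpm : p ≤ M u := by
        by_contra hcon
        obtain ⟨i, hi, h⟩ := hR.maximal (by simp only [dropColumn]; omega) (by
          have := hC.lt_tb (M u) p (by omega) hp
          have := hC.t_le (M u) (by omega)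
          simp only [dropColumn, removeAt]
          rw [if_pos (by omega)]
          omega)
        simp only [dropColumn, removeAt] at h
        rw [if_pos (by omega), if_pos (by omega)] at h
        have h1 := hC.no_bbb i (M u) p hi (by omega) hp h
        have h2 := hC.b_inj (M u) p (by omega) hp
        have h3 := hC.b_le (M u) (by omega)
        omega
      refine extend s M true (if p = 0 then M u + 1 else p) hA ⟨fun _ => ?_, by simp⟩ ?_
      · split_ifs <;> omega
      · rw [if_pos rfl, ← hCeq]
        congr 1
        unfold bottomIndex
        split_ifs <;> omega
    · obtain ⟨s, M, hA, hB⟩ := ih (by omega) (setTop_open_valid hu hC hp ht)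
      obtain ⟨hV, hR, hO⟩ := build_spec (by omega : u < K) hA
      have hCeq : setTop (u + 1) p (build K s M u) = C := by
        rw [hB]
        simp only [setTop, Function.update_idem]
        rw [← ht, Function.update_eq_self]
      have hle := hA.le_height
      have hopen : (build K s M u).t p = K := by
        rw [hB]
        simp [setTop]
      have hpN : p < (build K s M u).N := by
        rw [hB]
        exact hp
      by_cases hpm : p < M u
      · refine extend s M false p hA ⟨by simp, fun _ => ⟨by omega, by omega⟩⟩ ?_
        simpa [topIndex, hpm] using hCeq
      · refine extend s M false (M u) hA ⟨by simp, fun _ => ⟨le_rfl, ?_⟩⟩ ?_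
        · rw [← hO]
          exact lt_openCount hR (by omega) hpN hopen
        · have hlast : lastOpen K (build K s M u) = p := by
            obtain ⟨c1, c2, c3, c4⟩ := lastOpen_spec (by omega) hV hpN hopen
            by_contra hne
            generalize lastOpen K (build K s M u) = q at *
            have hqN : q < C.N := by
              rw [hB] at c2
              exact c2
            have hqK : C.t q = K := by
              rw [hB] at c3
              simpa [setTop, hne] using c3
            have hmN : M u < C.N := by omega
            have hmax := hR.maximal
            rw [hB] at hmax
            simp only [setTop, Function.update_apply] at hmax
            have hle1 : M u ≤ p := by omega
            have hlt2 : p < q := by omega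
            clear ih extend
            by_cases hmK : (if M u = p then K else C.t (M u)) = K
            · obtain ⟨i, hi, h⟩ := hmax hmN hmK
              clear hmax
              have h1 := hC.no_bbtt i (M u) p q hi hle1 hlt2 hqN h
              have h2 := hC.b_le (M u) hmN
              have h3 := hC.b_ne_t (M u) p hmN hp
              omega
            · split_ifs at hmK with hmp
              · exact hmK rfl
              · clear hmax
                have h1 := hC.no_ttt (M u) p q (by omega) hlt2 hqN
                have h2 := hC.t_le (M u) hmN
                have h3 := hC.t_inj (M u) p (by omega) hp
                omega
          simp only [Bool.false_eq_true, if_false, topIndex, lt_self_iff_false]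
          rw [hlast, hCeq]

theorem build_bottom_iff {K : ℕ} {s : ℕ → Bool} {M : ℕ → ℕ} {u v : ℕ} (hu : u < K)
    (h : Admissible s M u) (hv : v < u) :
    s v = true ↔ ∃ i < (build K s M u).N, (build K s M u).b i = v + 1 := by
  induction u with
  | zero => omega
  | succ u ih =>
    have ih := ih (by omega) (h.mono (by omega))
    obtain ⟨hV, hR, hO⟩ := build_spec (by omega : u < K) (h.mono (Nat.le_succ u))
    obtain ⟨hup, hdown⟩ := h.2 u (by omega)
    unfold build
    have hb := hV.b_le
    by_cases hvu : v = u
    · subst hvu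
      cases hs : s v
      · simp only [Bool.false_eq_true, if_false, setTop, false_iff]
        grind
      · have := bottomIndex_le (hup hs).2
        have := hR.le
        simp only [if_true, addBottom, true_iff]
        exact ⟨bottomIndex (M v) (M (v + 1)), by omega, by simp [insertAt]⟩
    · rw [ih (by omega)]
      cases hs : s u
      · simp [setTop]
      · have hp := (bottomIndex_le (hup hs).2).trans hR.le
        have hj := (hV.junk _ le_rfl).1
        simp only [if_true, addBottom, insertAt]
        generalize bottomIndex (M u) (M (u + 1)) = p at hp
        constructor
        · rintro ⟨i, hi, h⟩
          exact ⟨if i < p then i else i + 1, by grind, by grind⟩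
        · rintro ⟨i, hi, h⟩
          split_ifs at h
          · refine ⟨i, ?_, h⟩
            rcases Nat.lt_succ_iff_lt_or_eq.mp hi with hi | rfl <;> omega
          · omega
          · exact ⟨i - 1, by omega, h⟩

theorem build_injective {K : ℕ} {s s' : ℕ → Bool} {M M' : ℕ → ℕ} {u : ℕ} (hu : u < K)
    (h : Admissible s M u) (h' : Admissible s' M' u) (heq : build K s M u = build K s' M' u) :
    (∀ i < u, s i = s' i) ∧ ∀ i ≤ u, M i = M' i := by
  induction u with
  | zero =>
    refine ⟨by simp, fun i hi => ?_⟩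
    obtain rfl : i = 0 := by omega
    rw [h.1, h'.1]
  | succ u ih =>
    have hsu : s u = s' u := by
      have h1 := build_bottom_iff hu h (Nat.lt_succ_self u)
      have h2 := build_bottom_iff hu h' (Nat.lt_succ_self u)
      rw [heq, ← h2] at h1
      exact Bool.eq_iff_iff.mpr h1
    have hMu : M (u + 1) = M' (u + 1) := by
      have h1 := (build_spec hu h).2.1
      rw [heq] at h1
      exact h1.unique (build_spec hu h').2.1
    have hprev : build K s M u = build K s' M' u := by
      obtain ⟨hV, hR, hO⟩ := build_spec (by omega : u < K) (h.mono (Nat.le_succ u))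
      obtain ⟨hV', hR', hO'⟩ := build_spec (by omega : u < K) (h'.mono (Nat.le_succ u))
      have hW := (build_spec hu h).1
      obtain ⟨hup, hdown⟩ := h.2 u (by omega)
      obtain ⟨hup', hdown'⟩ := h'.2 u (by omega)
      rw [← hsu] at hup' hdown'
      cases hs : s u
      · obtain ⟨d1, d2⟩ := hdown hs
        obtain ⟨d1', d2'⟩ := hdown' hs
        rw [← hO] at d2
        rw [← hO'] at d2'
        obtain ⟨e1, e2, -⟩ := topIndex_spec (by omega) hV hR d1 d2
        obtain ⟨e1', e2', -⟩ := topIndex_spec (by omega) hV' hR' d1' d2'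
        simp only [build, ← hsu, hs, Bool.false_eq_true, if_false] at heq hW
        generalize topIndex K (M u) (M (u + 1)) (build K s M u) = q at *
        generalize topIndex K (M' u) (M' (u + 1)) (build K s' M' u) = q' at *
        generalize build K s M u = C at *
        generalize build K s' M' u = C' at *
        have hN : C.N = C'.N := (Columns.mk.inj heq).1
        have hb : C.b = C'.b := (Columns.mk.inj heq).2.1
        have ht : Function.update C.t q (u + 1) = Function.update C'.t q' (u + 1) :=
          (Columns.mk.inj heq).2.2
        have hqq : q = q' := by
          by_contra hne
          have := congrFun ht q
          simp only [Function.update_self, Function.update_of_ne hne] at this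
          have := hV'.t_le q (by omega)
          omega
        subst hqq
        ext i
        · exact hN
        · rw [hb]
        · by_cases hi : i = q
          · rw [hi, e2, e2']
          · have := congrFun ht i
            simpa [Function.update_of_ne hi] using this
      · have hl := (bottomIndex_le (hup hs).2).trans hR.le
        have hl' := (bottomIndex_le (hup' hs).2).trans hR'.le
        simp only [build, ← hsu, hs, if_true] at heq
        generalize bottomIndex (M u) (M (u + 1)) = p at *
        generalize bottomIndex (M' u) (M' (u + 1)) = p' at *
        have hpp : p = p' := by
          by_contra hne
          have hN : (build K s M u).N + 1 = (build K s' M' u).N + 1 := congrArg Columns.N heq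
          have := congrFun (congrArg Columns.b heq) p
          simp only [addBottom, insertAt] at this
          have := hV'.b_le
          have := hV'.junk
          grind
        subst hpp
        have := congrArg (dropColumn p) heq
        rwa [dropColumn_addBottom, dropColumn_addBottom] at this
    obtain ⟨g1, g2⟩ := ih (by omega) (h.mono (by omega)) (h'.mono (by omega)) hprev
    refine ⟨fun i hi => ?_, fun i hi => ?_⟩
    · rcases Nat.lt_succ_iff_lt_or_eq.mp hi with hi | rfl
      · exact g1 i hi
      · exact hsu
    · rcases Nat.le_succ_iff.mp hi with hi | rfl
      · exact g2 i hi
      · exact hMu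

end Columns

theorem List.getD_map_range {α : Type*} {m i : ℕ} (f : ℕ → α) (d : α) (hi : i < m) :
    ((List.range m).map f).getD i d = f i := by
  simp [hi]

theorem count_take_succ {l : List Bool} {k : ℕ} (hk : k < l.length) (b : Bool) :
    (l.take (k + 1)).count b = (l.take k).count b + if l.getD k false = b then 1 else 0 := by
  rw [List.take_succ_eq_append_getElem hk, List.count_append, List.getD_eq_getElem _ _ hk]
  cases b <;> cases l[k] <;> simp

theorem IsDyck.count_true_eq {l : List Bool} (h : IsDyck l) {k : ℕ} (hk : k ≤ l.length) :
    (l.take k).count true =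
      (l.take k).count false + Columns.height (fun i => l.getD i false) k := by
  induction k with
  | zero => simp [Columns.height]
  | succ k ih =>
    have h1 := ih (by omega)
    have h2 := h.1 (k + 1)
    have h3 := count_take_succ (l := l) (k := k) (by omega) true
    have h4 := count_take_succ (l := l) (k := k) (by omega) false
    simp only [Columns.height]
    rcases Bool.eq_false_or_eq_true (l.getD k false) with hs | hs <;>
      simp only [hs] at h3 h4 ⊢ <;>
      simp only [reduceCtorEq, if_true, if_false] at h3 h4 ⊢ <;> omega

theorem IsDyck.ht_eq {l : List Bool} (h : IsDyck l) {k : ℕ} (hk : k ≤ l.length) :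
    ht l k = Columns.height (fun i => l.getD i false) k := by
  have := h.count_true_eq hk
  unfold ht
  omega

theorem IsDyck.height_length {l : List Bool} (h : IsDyck l) :
    Columns.height (fun i => l.getD i false) l.length = 0 := by
  have h1 := h.count_true_eq le_rfl
  have h2 := h.2
  simp only [List.take_length] at h1
  omega

theorem IsDyck.height_pos {l : List Bool} (h : IsDyck l) {k : ℕ} (hk : k < l.length)
    (hs : l.getD k false = false) : 0 < Columns.height (fun i => l.getD i false) k := by
  have h1 := h.count_true_eq hk.le
  have h2 := h.1 (k + 1)
  have h3 := count_take_succ hk true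
  have h4 := count_take_succ hk false
  simp only [hs] at h3 h4
  simp at h3 h4
  omega

theorem isDyck_of_height {l : List Bool}
    (h : ∀ i < l.length, l.getD i false = false → 0 < Columns.height (fun i => l.getD i false) i)
    (h0 : Columns.height (fun i => l.getD i false) l.length = 0) : IsDyck l := by
  have key : ∀ k ≤ l.length, (l.take k).count true =
      (l.take k).count false + Columns.height (fun i => l.getD i false) k := by
    intro k hk
    induction k with
    | zero => simp [Columns.height]
    | succ k ih =>
      have h1 := ih (by omega)
      have h2 := h k (by omega)
      have h3 := count_take_succ (l := l) (k := k) (by omega) true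
      have h4 := count_take_succ (l := l) (k := k) (by omega) false
      simp only [Columns.height]
      rcases Bool.eq_false_or_eq_true (l.getD k false) with hs | hs <;>
        simp only [hs] at h2 h3 h4 ⊢ <;>
        simp only [reduceCtorEq, if_true, if_false, forall_true_left] at h2 h3 h4 ⊢ <;> omega
  refine ⟨fun k => ?_, ?_⟩
  · rcases le_total k l.length with hk | hk
    · have := key k hk
      omega
    · have := key _ le_rfl
      simp only [List.take_length] at this
      rw [List.take_of_length_le hk]
      omega
  · have := key _ le_rfl
    simp only [List.take_length] at this
    omega

namespace WDP

/-- The steps of a path as a function, `true` standing for an up-step. -/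
def step (p : WDP) (i : ℕ) : Bool := p.steps.getD i false

/-- The sequence of run lengths encoded by the weights of a path. -/
def runLength (p : WDP) : ℕ → ℕ
  | 0 => 0
  | i + 1 =>
    if p.step i = true then Columns.height p.step (i + 1) - p.weights.getD i 0
    else p.weights.getD i 0

/-- The weighted path with `m` steps `s` whose run lengths are given by `M`. -/
def ofRunLength (m : ℕ) (s : ℕ → Bool) (M : ℕ → ℕ) : WDP :=
  ⟨(List.range m).map s,
    (List.range m).map fun i =>
      if s i = true then Columns.height s (i + 1) - M (i + 1) else M (i + 1)⟩

theorem step_ofRunLength {s : ℕ → Bool} {M : ℕ → ℕ} {m i : ℕ} (hi : i < m) :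
    (ofRunLength m s M).step i = s i := List.getD_map_range s false hi

end WDP

theorem IsWD.admissible {n : ℕ} {p : WDP} (h : IsWD n p) :
    Columns.Admissible p.step p.runLength (2 * n) := by
  obtain ⟨hl, hlw, hD, h1, h2, h3, h4, h5⟩ := h
  have hht : ∀ k ≤ 2 * n, ht p.steps k = Columns.height p.step k := fun k hk =>
    hD.ht_eq (by omega)
  refine ⟨rfl, fun i hi => ⟨fun hs => ?_, fun hs => ?_⟩⟩
  · have hw := h1 i hi
    have hH : Columns.height p.step (i + 1) = Columns.height p.step i + 1 := by
      simp [Columns.height, hs]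
    rw [hht i hi.le, hht (i + 1) hi] at hw
    have hM : p.runLength (i + 1) = Columns.height p.step (i + 1) - p.weights.getD i 0 := by
      simp [WDP.runLength, hs]
    refine ⟨by omega, ?_⟩
    rcases i with _ | i
    · simp only [Columns.height, WDP.runLength] at *
      omega
    · have hw' := h1 i (by omega)
      rw [hht i (by omega), hht (i + 1) (by omega)] at hw'
      cases hs' : p.step i
      · have hM' : p.runLength (i + 1) = p.weights.getD i 0 := by simp [WDP.runLength, hs']
        have := h5 i hi hs' hs
        rw [hht (i + 1) (by omega)] at this
        omega
      · have hM' : p.runLength (i + 1) = Columns.height p.step (i + 1) - p.weights.getD i 0 := by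
          simp [WDP.runLength, hs']
        have := h2 i hi hs' hs
        omega
  · have hw := h1 i hi
    have hpos := hD.height_pos (k := i) (by omega) hs
    change 0 < Columns.height p.step i at hpos
    have hH : Columns.height p.step (i + 1) = Columns.height p.step i - 1 := by
      simp [Columns.height, hs]
    rw [hht i hi.le, hht (i + 1) hi] at hw
    have hM : p.runLength (i + 1) = p.weights.getD i 0 := by simp [WDP.runLength, hs]
    refine ⟨?_, by omega⟩
    rcases i with _ | i
    · simp only [Columns.height, WDP.runLength] at *
      omega
    · have hw' := h1 i (by omega)
      rw [hht i (by omega), hht (i + 1) (by omega)] at hw'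
      cases hs' : p.step i
      · have hM' : p.runLength (i + 1) = p.weights.getD i 0 := by simp [WDP.runLength, hs']
        have := h3 i hi hs' hs
        omega
      · have hM' : p.runLength (i + 1) = Columns.height p.step (i + 1) - p.weights.getD i 0 := by
          simp [WDP.runLength, hs']
        have := h4 i hi hs' hs
        rw [hht (i + 1) (by omega)] at this
        omega

theorem IsWD.height_eq_zero {n : ℕ} {p : WDP} (h : IsWD n p) :
    Columns.height p.step (2 * n) = 0 := by
  rw [← h.1]
  exact h.2.2.1.height_length

theorem IsWD.ext {n : ℕ} {p q : WDP} (hp : IsWD n p) (hq : IsWD n q)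
    (hs : ∀ i < 2 * n, p.step i = q.step i) (hM : ∀ i ≤ 2 * n, p.runLength i = q.runLength i) :
    p = q := by
  have hsteps : p.steps = q.steps := by
    refine List.ext_getElem (by rw [hp.1, hq.1]) fun i h1 h2 => ?_
    have := hs i (by rw [← hp.1]; exact h1)
    simpa only [WDP.step, List.getD_eq_getElem, h1, h2] using this
  have hweights : p.weights = q.weights := by
    refine List.ext_getElem (by rw [hp.2.1, hq.2.1]) fun i h1 h2 => ?_
    have hi : i < 2 * n := by rw [← hp.2.1]; exact h1
    have e1 := hM (i + 1) hi
    have e2 := hs i hi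
    have w1 := hp.2.2.2.1 i hi
    have w2 := hq.2.2.2.1 i hi
    rw [hp.2.2.1.ht_eq (k := i + 1) (by rw [hp.1]; omega)] at w1
    rw [hq.2.2.1.ht_eq (k := i + 1) (by rw [hq.1]; omega)] at w2
    change _ ≤ min _ (Columns.height p.step (i + 1)) at w1
    change _ ≤ min _ (Columns.height q.step (i + 1)) at w2
    have e3 : Columns.height p.step (i + 1) = Columns.height q.step (i + 1) :=
      Columns.height_congr fun j hj => hs j (by omega)
    simp only [List.getD_eq_getElem, h1, h2] at w1 w2
    simp only [WDP.runLength, e2, e3, List.getD_eq_getElem, h1, h2] at e1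
    split_ifs at e1 <;> omega
  cases p
  cases q
  simp_all

namespace Columns

theorem Admissible.height_succ {s : ℕ → Bool} {M : ℕ → ℕ} {u i : ℕ} (h : Admissible s M u)
    (hi : i < u) : (s i = true → height s (i + 1) = height s i + 1) ∧
      (s i = false → height s i = height s (i + 1) + 1) := by
  have := (h.2 i hi).2
  refine ⟨fun hs => by simp [height, hs], fun hs => ?_⟩
  have := this hs
  simp [height, hs]
  omega

theorem Admissible.runLength_ofRunLength {s : ℕ → Bool} {M : ℕ → ℕ} {u i : ℕ}
    (h : Admissible s M u) (hi : i ≤ u) : (WDP.ofRunLength u s M).runLength i = M i := by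
  rcases i with _ | i
  · exact h.1.symm
  · have := (h.mono hi).le_height
    have hH : height (WDP.ofRunLength u s M).step (i + 1) = height s (i + 1) :=
      height_congr fun j hj => WDP.step_ofRunLength (by omega)
    have hw : (WDP.ofRunLength u s M).weights.getD i 0 =
        if s i = true then height s (i + 1) - M (i + 1) else M (i + 1) :=
      List.getD_map_range _ 0 (by omega)
    simp only [WDP.runLength, WDP.step_ofRunLength (show i < u by omega), hH, hw]
    split_ifs <;> omega

theorem Admissible.isWD {s : ℕ → Bool} {M : ℕ → ℕ} {n : ℕ} (h : Admissible s M (2 * n))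
    (h0 : height s (2 * n) = 0) : IsWD n (WDP.ofRunLength (2 * n) s M) := by
  have hs : ∀ i < 2 * n, (WDP.ofRunLength (2 * n) s M).steps.getD i false = s i := fun i hi =>
    List.getD_map_range s false hi
  have hw : ∀ i < 2 * n, (WDP.ofRunLength (2 * n) s M).weights.getD i 0 =
      if s i = true then height s (i + 1) - M (i + 1) else M (i + 1) := fun i hi =>
    List.getD_map_range _ 0 hi
  have hl : (WDP.ofRunLength (2 * n) s M).steps.length = 2 * n := by simp [WDP.ofRunLength]
  have hH : ∀ k ≤ 2 * n,
      height (fun i => (WDP.ofRunLength (2 * n) s M).steps.getD i false) k = height s k :=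
    fun k hk => height_congr fun i hi => hs i (by omega)
  have hD : IsDyck (WDP.ofRunLength (2 * n) s M).steps := by
    refine isDyck_of_height (fun i hi hf => ?_) ?_
    · rw [hl] at hi
      rw [hs i hi] at hf
      rw [hH i hi.le]
      have := (h.2 i hi).2 hf
      omega
    · rw [hl, hH _ le_rfl, h0]
  have hht : ∀ k ≤ 2 * n, ht (WDP.ofRunLength (2 * n) s M).steps k = height s k := fun k hk => by
    rw [hD.ht_eq (by omega), hH k hk]
  refine ⟨hl, by simp [WDP.ofRunLength], hD, fun i hi => ?_, fun i hi h1 h2 => ?_,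
    fun i hi h1 h2 => ?_, fun i hi h1 h2 => ?_, fun i hi h1 h2 => ?_⟩
  · rw [hw i hi, hht i hi.le, hht (i + 1) hi]
    have e1 := h.2 i hi
    have e2 := h.height_succ hi
    cases hc : s i <;> simp only [hc] at e1 e2 <;> simp at e1 e2 ⊢ <;> omega
  all_goals
    have hi' : i < 2 * n := by omega
    rw [hs i hi'] at h1
    rw [hs _ hi] at h2
    have e1 := h.2 (i + 1) hi
    have e2 := h.height_succ hi
    have e3 := (h.mono hi.le).le_height
    have e4 := (h.mono hi).le_height
    try rw [hht _ hi.le]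
    rw [hw i hi', hw _ hi]
    simp only [h1, h2] at e1 e2 ⊢
    simp at e1 e2 ⊢
    omega

end Columns

namespace Columns

/-- The word reading the columns from left to right, each one from bottom to top. -/
def word (n : ℕ) (C : Columns) : List ℕ :=
  (List.range (2 * n)).map fun i => if i % 2 = 0 then C.b (i / 2) else C.t (i / 2)

/-- The columns formed by consecutive pairs of letters of a word. -/
def ofWord (n : ℕ) (w : List ℕ) : Columns :=
  ⟨n, fun i => w.getD (2 * i) 0, fun i => w.getD (2 * i + 1) 0⟩

theorem length_word (n : ℕ) (C : Columns) : (word n C).length = 2 * n := by simp [word]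

theorem word_getD_even {n i : ℕ} (C : Columns) (hi : i < n) :
    (word n C).getD (2 * i) 0 = C.b i := by
  refine (List.getD_map_range _ 0 (by omega)).trans ?_
  rw [if_pos (by omega), show 2 * i / 2 = i by omega]

theorem word_getD_odd {n i : ℕ} (C : Columns) (hi : i < n) :
    (word n C).getD (2 * i + 1) 0 = C.t i := by
  refine (List.getD_map_range _ 0 (by omega)).trans ?_
  rw [if_neg (by omega), show (2 * i + 1) / 2 = i by omega]

theorem word_ofWord {n : ℕ} {w : List ℕ} (hw : w.length = 2 * n) : word n (ofWord n w) = w := by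
  refine List.ext_getElem (by rw [length_word, hw]) fun i h1 h2 => ?_
  rw [← List.getD_eq_getElem _ 0 h1, ← List.getD_eq_getElem _ 0 h2]
  rcases Nat.even_or_odd' i with ⟨j, rfl | rfl⟩
  · rw [word_getD_even _ (by omega)]
    rfl
  · rw [word_getD_odd _ (by omega)]
    rfl

theorem ofWord_word {K u n : ℕ} {C : Columns} (hC : Valid K u C) (hN : C.N = n) :
    ofWord n (word n C) = C := by
  ext i
  · exact hN.symm
  · rcases lt_or_ge i n with hi | hi
    · exact word_getD_even C hi
    · rw [(hC.junk i (by omega)).1]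
      exact List.getD_eq_default _ _ (by rw [length_word]; omega)
  · rcases lt_or_ge i n with hi | hi
    · exact word_getD_odd C hi
    · rw [(hC.junk i (by omega)).2]
      exact List.getD_eq_default _ _ (by rw [length_word]; omega)

theorem ofWord_valid {n : ℕ} {w : List ℕ} (h : IsA n w) :
    Valid (2 * n + 1) (2 * n) (ofWord n w) := by
  obtain ⟨hP, hU, hA⟩ := h
  have hnodup := hP.nodup
  obtain ⟨hl, hmem⟩ := hP
  have hout : ∀ i, 2 * n ≤ i → w.getD i 0 = 0 := fun i hi =>
    List.getD_eq_default _ _ (by omega)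
  have hbd : ∀ i < 2 * n, 1 ≤ w.getD i 0 ∧ w.getD i 0 ≤ 2 * n := by
    intro i hi
    rw [List.getD_eq_getElem _ _ (by omega)]
    exact Finset.mem_Icc.mp ((hmem _).mp (List.getElem_mem _))
  have hinj : ∀ i j, i < 2 * n → j < 2 * n → w.getD i 0 = w.getD j 0 → i = j := by
    intro i j hi hj hij
    rw [List.getD_eq_getElem _ _ (by omega), List.getD_eq_getElem _ _ (by omega)] at hij
    exact hnodup.getElem_inj_iff.mp hij
  have hsurj : ∀ v, 1 ≤ v → v ≤ 2 * n → ∃ i < 2 * n, w.getD i 0 = v := by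
    intro v hv1 hv2
    obtain ⟨i, hi, hv⟩ := List.getElem_of_mem ((hmem v).mpr (Finset.mem_Icc.mpr ⟨hv1, hv2⟩))
    exact ⟨i, by omega, by rw [List.getD_eq_getElem _ _ hi, hv]⟩
  have hup : ∀ i < n, w.getD (2 * i) 0 < w.getD (2 * i + 1) 0 := by
    intro i hi
    have := hU.1 (i + 1) (by omega) hi
    rwa [letter, letter, show 2 * (i + 1) - 1 - 1 = 2 * i by omega,
      show 2 * (i + 1) - 1 = 2 * i + 1 by omega] at this
  have hav : ∀ p q r s, p < q → q < r → r < s → s < 2 * n → w.getD p 0 < w.getD q 0 →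
      w.getD q 0 < w.getD r 0 → w.getD s 0 ≤ w.getD r 0 := by
    intro p q r s hpq hqr hrs hs h1 h2
    by_contra! h3
    exact hA ⟨p + 1, q + 1, r + 1, s + 1, by omega, by omega, by omega, by omega, by omega,
      h1, h2, h3⟩
  unfold ofWord
  generalize w.getD = f at *
  constructor <;> dsimp only
  · exact fun i hi => (hbd _ (by omega)).1
  · exact fun i hi => (hbd _ (by omega)).2
  · exact hup
  · exact fun i hi => Or.inl (hbd _ (by omega)).2
  · exact fun i hi => ⟨hout _ (by omega), hout _ (by omega)⟩
  · intro i j hij hj h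
    have := hinj _ _ (by omega) (by omega) h
    omega
  · intro i j hij hj h
    have := hinj _ _ (by omega) (by omega) h
    omega
  · intro i j hi hj h
    have := hinj _ _ (by omega) (by omega) h
    omega
  · intro v hv1 hv2
    obtain ⟨i, hi, rfl⟩ := hsurj v hv1 hv2
    rcases Nat.even_or_odd' i with ⟨j, rfl | rfl⟩
    · exact ⟨j, by omega, Or.inl rfl⟩
    · exact ⟨j, by omega, Or.inr rfl⟩
  · intro i j hij hj
    by_contra! hc
    have h1 : f (2 * i + 1) 0 ≠ f (2 * j) 0 := fun h => by
      have := hinj _ _ (by omega) (by omega) h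
      omega
    have h2 := hav (2 * i) (2 * i + 1) (2 * j) (2 * j + 1) (by omega) (by omega) (by omega)
      (by omega) (hup i (by omega)) (by omega)
    have := hup j hj
    omega
  · intro i j k hij hjk hk h
    by_contra! hc
    have := hav (2 * i) (2 * j) (2 * k) (2 * k + 1) (by omega) (by omega) (by omega) (by omega) h hc
    have := hup k hk
    omega
  · intro i j k hij hjk hk h
    exact hav (2 * i) (2 * i + 1) (2 * j + 1) (2 * k + 1) (by omega) (by omega) (by omega)
      (by omega) (hup i (by omega)) h
  · intro i j k l hij hjk hkl hl h1 h2
    exact hav (2 * i) (2 * j) (2 * k + 1) (2 * l + 1) (by omega) (by omega) (by omega)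
      (by omega) h1 h2

theorem Valid.isA_word {n : ℕ} {C : Columns} (hC : Valid (2 * n + 1) (2 * n) C) (hN : C.N = n)
    (hopen : openCount (2 * n + 1) C = 0) : IsA n (word n C) := by
  have ht : ∀ i < n, C.t i ≤ 2 * n := by
    intro i hi
    refine (hC.t_le i (by omega)).resolve_right fun h => ?_
    have := Finset.card_eq_zero.mp hopen
    have hmem : i ∈ (Finset.range C.N).filter (fun i => C.t i = 2 * n + 1) := by simp; omega
    rw [this] at hmem
    simp at hmem
  have he := fun i => word_getD_even (n := n) (i := i) C
  have ho := fun i => word_getD_odd (n := n) (i := i) C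
  refine ⟨⟨length_word n C, fun k => ?_⟩, ⟨fun i hi1 hi2 => ?_, fun i hi1 hi2 => ?_⟩, ?_⟩
  · rw [Finset.mem_Icc]
    constructor
    · intro hk
      obtain ⟨i, hi, rfl⟩ := List.mem_map.mp hk
      rw [List.mem_range] at hi
      have h1 := hC.b_pos (i / 2) (by omega)
      have h2 := hC.b_le (i / 2) (by omega)
      have h3 := hC.b_lt_t (i / 2) (by omega)
      have h4 := ht (i / 2) (by omega)
      split_ifs <;> omega
    · rintro ⟨h1, h2⟩
      obtain ⟨i, hi, h | h⟩ := hC.surj k h1 h2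
      · exact List.mem_map.mpr ⟨2 * i, List.mem_range.mpr (by omega), by
          rw [if_pos (by omega), show 2 * i / 2 = i by omega, h]⟩
      · exact List.mem_map.mpr ⟨2 * i + 1, List.mem_range.mpr (by omega), by
          rw [if_neg (by omega), show (2 * i + 1) / 2 = i by omega, h]⟩
  · obtain ⟨j, rfl⟩ : ∃ j, i = j + 1 := ⟨i - 1, by omega⟩
    rw [letter, letter, show 2 * (j + 1) - 1 - 1 = 2 * j by omega,
      show 2 * (j + 1) - 1 = 2 * j + 1 by omega, he j hi2, ho j hi2]
    exact hC.b_lt_t j (by omega)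
  · obtain ⟨j, rfl⟩ : ∃ j, i = j + 1 := ⟨i - 1, by omega⟩
    simp only [letter, Nat.add_sub_cancel, show 2 * (j + 1) - 1 = 2 * j + 1 by omega]
    rw [he (j + 1) (by omega), ho j (by omega)]
    exact hC.lt_tb j (j + 1) (by omega) (by omega)
  · rintro ⟨p, q, r, s, hp, hpq, hqr, hrs, hs, h1, h2, h3⟩
    rw [length_word] at hs
    obtain ⟨p, rfl⟩ : ∃ j, p = j + 1 := ⟨p - 1, by omega⟩
    obtain ⟨q, rfl⟩ : ∃ j, q = j + 1 := ⟨q - 1, by omega⟩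
    obtain ⟨r, rfl⟩ : ∃ j, r = j + 1 := ⟨r - 1, by omega⟩
    obtain ⟨s, rfl⟩ : ∃ j, s = j + 1 := ⟨s - 1, by omega⟩
    simp only [letter, Nat.add_sub_cancel] at h1 h2 h3
    have hlt : ∀ i j, i < j → j < n → C.b j < C.t i := fun i j hij hj =>
      hC.lt_tb i j hij (by omega)
    obtain ⟨i, rfl | rfl⟩ := Nat.even_or_odd' p <;> obtain ⟨j, rfl | rfl⟩ := Nat.even_or_odd' q <;>
      obtain ⟨k, rfl | rfl⟩ := Nat.even_or_odd' r <;>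
      obtain ⟨l, rfl | rfl⟩ := Nat.even_or_odd' s <;>
      simp only [he i (by omega), ho i (by omega), he j (by omega), ho j (by omega),
        he k (by omega), ho k (by omega), he l (by omega), ho l (by omega)] at h1 h2 h3 <;>
      have e1 := hlt i j <;> have e2 := hlt j k <;> have e3 := hlt k l <;>
      have e4 := hC.no_bbb i j k <;> have e5 := hC.no_bbtt i j k l <;>
      have e6 := hC.no_ttt j k l <;> omega

theorem two_mul_build_N {K : ℕ} {s : ℕ → Bool} {M : ℕ → ℕ} {u : ℕ} (h : Admissible s M u) :
    2 * (build K s M u).N = u + height s u := by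
  induction u with
  | zero => rfl
  | succ u ih =>
    have h1 := ih (h.mono (by omega))
    have h2 := (h.2 u (by omega)).2
    unfold build height
    cases hs : s u
    · have := h2 hs
      simp [setTop]
      omega
    · simp [addBottom]
      omega

theorem isA_word_build {s : ℕ → Bool} {M : ℕ → ℕ} {n : ℕ} (h : Admissible s M (2 * n))
    (h0 : height s (2 * n) = 0) : IsA n (word n (build (2 * n + 1) s M (2 * n))) := by
  obtain ⟨hV, -, hO⟩ := build_spec (lt_add_one _) h
  have := two_mul_build_N (K := 2 * n + 1) h
  exact hV.isA_word (by omega) (hO.trans h0)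

end Columns

/-- There is a bijection `β` from `WD_{2n}` onto `A_{2n}(1234)` such that the
set of positions of the up-steps of `wd` equals the set of bottom elements
(values at odd positions) of `β(wd)`. -/
theorem exists_bijection_WD_A (n : ℕ) (hn : 1 ≤ n) :
    ∃ β : {p : WDP // IsWD n p} → {w : List ℕ // IsA n w},
      Function.Bijective β ∧
      ∀ p : {p : WDP // IsWD n p},
        {u : ℕ | 1 ≤ u ∧ u ≤ 2 * n ∧ p.1.steps.getD (u - 1) false = true} =
        {u : ℕ | ∃ i, 1 ≤ i ∧ i ≤ n ∧ letter (β p).1 (2 * i - 1) = u} := by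
  let C : WDP → Columns := fun p => Columns.build (2 * n + 1) p.step p.runLength (2 * n)
  have hN : ∀ p, IsWD n p → (C p).N = n := fun p hp => by
    have h1 : 2 * (C p).N = _ := Columns.two_mul_build_N hp.admissible
    rw [hp.height_eq_zero] at h1
    omega
  have hV : ∀ p, IsWD n p → Columns.Valid (2 * n + 1) (2 * n) (C p) := fun p hp =>
    (Columns.build_spec (lt_add_one _) hp.admissible).1
  refine ⟨fun p => ⟨Columns.word n (C p.1),
    Columns.isA_word_build p.2.admissible p.2.height_eq_zero⟩, ⟨?_, ?_⟩, ?_⟩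
  · rintro ⟨p, hp⟩ ⟨q, hq⟩ hpq
    have hw : Columns.word n (C p) = Columns.word n (C q) := congrArg Subtype.val hpq
    have hC : C p = C q := by
      rw [← Columns.ofWord_word (hV p hp) (hN p hp), hw, Columns.ofWord_word (hV q hq) (hN q hq)]
    obtain ⟨h1, h2⟩ := Columns.build_injective (lt_add_one _) hp.admissible hq.admissible hC
    exact Subtype.ext (hp.ext hq h1 h2)
  · rintro ⟨w, hw⟩
    have hVw := Columns.ofWord_valid hw
    obtain ⟨s, M, hs, hB⟩ := Columns.exists_build (lt_add_one _) hVw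
    have h0 : Columns.height s (2 * n) = 0 := by
      have := Columns.two_mul_build_N (K := 2 * n + 1) hs
      rw [hB] at this
      have h' : (Columns.ofWord n w).N = n := rfl
      omega
    refine ⟨⟨_, hs.isWD h0⟩, Subtype.ext ?_⟩
    change Columns.word n (C _) = w
    rw [← Columns.word_ofWord hw.1.1, ← hB]
    congr 1
    exact Columns.build_congr (fun i hi => WDP.step_ofRunLength hi)
      fun i hi => hs.runLength_ofRunLength hi
  · rintro ⟨p, hp⟩
    ext u
    have hletter : ∀ i, i < n → letter (Columns.word n (C p)) (2 * (i + 1) - 1) = (C p).b i := by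
      intro i hi
      rw [letter, show 2 * (i + 1) - 1 - 1 = 2 * i by omega, Columns.word_getD_even _ hi]
    constructor
    · rintro ⟨h1, h2, h3⟩
      obtain ⟨i, hi, hb⟩ := (Columns.build_bottom_iff (K := 2 * n + 1) (lt_add_one _)
        hp.admissible (v := u - 1) (by omega)).mp h3
      change i < (C p).N at hi
      rw [hN p hp] at hi
      refine ⟨i + 1, by omega, hi, ?_⟩
      rw [hletter i hi]
      change (C p).b i = _ at hb
      omega
    · rintro ⟨i, h1, h2, h3⟩
      obtain ⟨i, rfl⟩ : ∃ j, i = j + 1 := ⟨i - 1, by omega⟩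
      rw [hletter i h2] at h3
      have hi : i < (C p).N := by rw [hN p hp]; omega
      have h4 := (hV p hp).b_pos i hi
      have h5 := (hV p hp).b_le i hi
      exact ⟨by omega, by omega, (Columns.build_bottom_iff (K := 2 * n + 1) (lt_add_one _)
        hp.admissible (v := u - 1) (by omega)).mpr ⟨i, hi, by change (C p).b i = _; omega⟩⟩
end

section
/- For every positive integer n there exists an injection from the set WD_{2n} of weighted Dyck paths of length 2n into the set A_{2n}(1234) of up-down permutations of size 2n avoiding 1234 which sends each weighted Dyck path wd to a permutation whose set of bottom elements (values at odd positions) equals the set of positions of the up-steps of wd. -/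
/-- Every strictly increasing sublist of `l` has at most `m` entries. -/
def NoInc (m : ℕ) (l : List ℕ) : Prop :=
  ∀ t : List ℕ, t.Sublist l → t.Pairwise (· < ·) → t.length ≤ m

theorem NoInc.sublist {m : ℕ} {l l' : List ℕ} (h : NoInc m l) (hl : l'.Sublist l) : NoInc m l' :=
  fun t ht hp => h t (ht.trans hl) hp

theorem NoInc.mono {m m' : ℕ} {l : List ℕ} (h : NoInc m l) (hm : m ≤ m') : NoInc m' l :=
  fun t ht hp => (h t ht hp).trans hm

theorem noInc_nil (m : ℕ) : NoInc m [] := by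
  intro t ht _
  simp [List.sublist_nil.1 ht]

/-- Inserting a new maximum after `X` lengthens an increasing sublist only if it ends there. -/
theorem NoInc.insert_max {m v : ℕ} {X Y : List ℕ} (hX : NoInc m X) (hXY : NoInc (m + 1) (X ++ Y))
    (hv : ∀ x ∈ Y, x < v) : NoInc (m + 1) (X ++ v :: Y) := by
  intro t ht hp
  obtain ⟨t₁, t₂, rfl, h₁, h₂⟩ := List.sublist_append_iff.1 ht
  rcases List.sublist_cons_iff.1 h₂ with h | ⟨r, rfl, hr⟩
  · exact hXY _ (h₁.append h) hp
  · obtain ⟨hp₁, hp₂, -⟩ := List.pairwise_append.1 hp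
    have hnil : r = [] := by
      refine List.eq_nil_iff_forall_not_mem.2 fun x hx => ?_
      have := (List.pairwise_cons.1 hp₂).1 x hx
      have := hv x (hr.subset hx)
      omega
    subst hnil
    have := hX _ h₁ hp₁
    simpa using this

/-- Adjacent letters of an alternating word whose valleys are the letters satisfying `P`. -/
def AltRel (P : ℕ → Prop) (x y : ℕ) : Prop :=
  (P x ∧ ¬P y ∧ x < y) ∨ (¬P x ∧ P y ∧ y < x)

/-- An alternating word starting and ending with a valley; the valleys are the letters
satisfying `P`. -/
structure IsBlock (P : ℕ → Prop) (B : List ℕ) : Prop where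
  ne_nil : B ≠ []
  chain : B.IsChain (AltRel P)
  head : ∀ x ∈ B.head?, P x
  last : ∀ x ∈ B.getLast?, P x

theorem isBlock_singleton {P : ℕ → Prop} {v : ℕ} (hv : P v) : IsBlock P [v] :=
  ⟨by simp, by simp, by simpa using hv, by simpa using hv⟩

theorem IsBlock.merge {P : ℕ → Prop} {B C : List ℕ} {v : ℕ} (hB : IsBlock P B) (hC : IsBlock P C)
    (hv : ¬P v) (hBv : ∀ x ∈ B, x < v) (hCv : ∀ x ∈ C, x < v) : IsBlock P (B ++ v :: C) := by
  refine ⟨by simp, ?_, ?_, ?_⟩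
  · rw [List.isChain_append]
    refine ⟨hB.chain, ?_, ?_⟩
    · rw [List.isChain_cons]
      exact ⟨fun y hy => Or.inr ⟨hv, hC.head y hy, hCv y (List.mem_of_mem_head? hy)⟩, hC.chain⟩
    · intro x hx y hy
      have : y = v := by simpa using hy.symm
      subst this
      exact Or.inl ⟨hB.last x hx, hv, hBv x (List.mem_of_getLast? hx)⟩
  · intro x hx
    obtain ⟨b, B', rfl⟩ := List.exists_cons_of_ne_nil hB.ne_nil
    exact hB.head x (by simpa using hx)
  · intro x hx
    obtain ⟨C', c, rfl⟩ := (List.eq_nil_or_concat' C).resolve_left hC.ne_nil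
    refine hC.last x ?_
    have h : B ++ v :: (C' ++ [c]) = (B ++ v :: C') ++ [c] := by simp
    rw [h, List.getLast?_append] at hx
    simpa using hx

/-- The index at which the next value is inserted, given the numbers `a` and `a'` of gaps
preceded by no ascent before and after the insertion and the number `l` of blocks. -/
def insertPos (l : ℕ) (u : Bool) (a a' : ℕ) : ℕ :=
  match u with
  | true => if a' = a + 1 then 0 else a'
  | false => if a' = a then l - 2 else a'

/-- Insertion of a new largest value `v` at index `j` into a list of blocks: as a new block if `u`
holds, and as a peak joining two consecutive blocks otherwise. -/
def insertValue (v : ℕ) (u : Bool) (j : ℕ) (bs : List (List ℕ)) : List (List ℕ) :=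
  match u with
  | true => bs.take j ++ [v] :: bs.drop j
  | false => bs.take j ++ (bs.getD j [] ++ v :: bs.getD (j + 1) []) :: bs.drop (j + 2)

/-- The blocks formed by the values `0, …, k`. -/
def blocks (s : ℕ → Bool) (a : ℕ → ℕ) : ℕ → List (List ℕ)
  | 0 => [[0]]
  | k + 1 => insertValue (k + 1) (s k) (insertPos (blocks s a k).length (s k) (a k) (a (k + 1)))
      (blocks s a k)

theorem exists_split_pair {j : ℕ} {bs : List (List ℕ)} (hj : j + 1 < bs.length) :
    ∃ X B C Y, bs = X ++ B :: C :: Y ∧ X.length = j ∧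
      ∀ v, insertValue v false j bs = X ++ (B ++ v :: C) :: Y := by
  refine ⟨bs.take j, bs[j], bs[j + 1], bs.drop (j + 2), ?_, by simp; omega, fun v => ?_⟩
  · rw [← List.drop_eq_getElem_cons hj, ← List.drop_eq_getElem_cons (by omega),
      List.take_append_drop]
  · simp [insertValue, List.getD_eq_getElem?_getD, List.getElem?_eq_getElem hj,
      List.getElem?_eq_getElem (show j < bs.length by omega)]

/-- The invariant of the insertion process: `v` is the next value to be inserted, `h + 1` is the
number of blocks, and the first `a` blocks contain no ascent. -/
structure IsState (P : ℕ → Prop) (v h a : ℕ) (bs : List (List ℕ)) : Prop where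
  length : bs.length = h + 1
  perm : bs.flatten.Perm (List.range v)
  last : ∀ B ∈ bs.getLast?, B.getLast? = some 0
  block : ∀ B ∈ bs, IsBlock P B
  inc₁ : NoInc 1 (bs.take a).flatten
  inc₂ : NoInc 2 bs.dropLast.flatten
  inc₃ : NoInc 3 bs.flatten

theorem IsState.lt {P : ℕ → Prop} {v h a : ℕ} {bs : List (List ℕ)} (S : IsState P v h a bs)
    {x : ℕ} (hx : x ∈ bs.flatten) : x < v := by
  simpa using S.perm.subset hx

theorem perm_range_succ_of_append {v : ℕ} {X Y : List ℕ} (h : (X ++ Y).Perm (List.range v)) :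
    (X ++ v :: Y).Perm (List.range (v + 1)) := by
  rw [List.range_succ]
  exact (List.perm_middle.trans (h.cons v)).trans (List.perm_append_singleton v _).symm

theorem IsState.up {P : ℕ → Prop} {v h a a' : ℕ} {bs : List (List ℕ)} (S : IsState P v h a bs)
    (hP : P v) (hah : a ≤ h) (h₁ : 1 ≤ a') (h₂ : a' ≤ a + 1) :
    IsState P (v + 1) (h + 1) a'
      (insertValue v true (insertPos bs.length true a a') bs) := by
  obtain ⟨j, hj⟩ : ∃ j, insertPos bs.length true a a' = j := ⟨_, rfl⟩
  have hja : j ≤ a := by simp only [insertPos] at hj; split_ifs at hj <;> omega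
  obtain ⟨X, Y, rfl, hX⟩ : ∃ X Y, bs = X ++ Y ∧ X.length = j :=
    ⟨bs.take j, bs.drop j, by simp, by have := S.length; simp; omega⟩
  have hY : Y ≠ [] := by
    rintro rfl
    have := S.length
    simp at this; omega
  have hins : insertValue v true (insertPos (X ++ Y).length true a a') (X ++ Y) =
      X ++ [v] :: Y := by
    rw [hj]; simp [insertValue, ← hX]
  rw [hins]
  have hlt : ∀ x ∈ Y.flatten, x < v := fun x hx => S.lt (by simp_all)
  have hX₁ : NoInc 1 X.flatten := S.inc₁.sublist <| by
    refine List.Sublist.flatten ?_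
    rw [List.take_append, List.take_of_length_le (by omega)]
    exact List.sublist_append_left _ _
  refine ⟨?_, ?_, ?_, ?_, ?_, ?_, ?_⟩
  · have := S.length
    simp at this ⊢; omega
  · have := S.perm
    rw [List.flatten_append] at this
    simpa using perm_range_succ_of_append this
  · intro B hB
    refine S.last B ?_
    obtain ⟨Y', c, rfl⟩ := (List.eq_nil_or_concat' Y).resolve_left hY
    rw [show X ++ [v] :: (Y' ++ [c]) = (X ++ [v] :: Y') ++ [c] by simp,
      List.getLast?_append] at hB
    rw [← List.append_assoc, List.getLast?_append]
    simpa using hB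
  · intro B hB
    have hB' : B = [v] ∨ B ∈ X ++ Y := by
      simp at hB ⊢; tauto
    rcases hB' with rfl | hB'
    · exact isBlock_singleton hP
    · exact S.block B hB'
  · simp only [insertPos] at hj
    split_ifs at hj with h
    · have hX0 : X = [] := List.eq_nil_of_length_eq_zero (by omega)
      subst hX0
      subst h
      have h3 : ∀ x ∈ (Y.take a).flatten, x < v := fun x hx =>
        hlt x ((List.take_sublist a Y).flatten.subset hx)
      have := NoInc.insert_max (noInc_nil 0) (by simpa using S.inc₁) h3
      simpa using this
    · rw [List.take_append, List.take_of_length_le (by omega)]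
      simpa [hX, hj] using hX₁
  · have h4 := S.inc₂
    rw [List.dropLast_append_of_ne_nil hY, List.flatten_append] at h4
    rw [List.dropLast_append_of_ne_nil (by simp), List.dropLast_cons_of_ne_nil hY]
    have := hX₁.insert_max h4 (fun x hx =>
      hlt x ((List.dropLast_sublist Y).flatten.subset hx))
    simpa using this
  · have h4 := S.inc₃
    rw [List.flatten_append] at h4
    have := (hX₁.mono (show 1 ≤ 2 by omega)).insert_max h4 hlt
    simpa using this

theorem IsState.down {P : ℕ → Prop} {v h a a' : ℕ} {bs : List (List ℕ)}
    (S : IsState P v (h + 1) a bs) (hP : ¬P v) (h₁ : a' ≤ a) (h₂ : a' ≤ h) :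
    insertPos bs.length false a a' + 1 < bs.length ∧
    IsState P (v + 1) h a' (insertValue v false (insertPos bs.length false a a') bs) := by
  obtain ⟨j, hj⟩ : ∃ j, insertPos bs.length false a a' = j := ⟨_, rfl⟩
  have hlen := S.length
  have hjl : j + 1 < bs.length := by simp only [insertPos] at hj; split_ifs at hj <;> omega
  rw [hj]
  refine ⟨hjl, ?_⟩
  obtain ⟨X, B, C, Y, rfl, hX, hins⟩ := exists_split_pair hjl
  rw [hins]
  have hlt : ∀ x ∈ (X ++ B :: C :: Y).flatten, x < v := fun x hx => S.lt hx
  have hfl : (X ++ (B ++ v :: C) :: Y).flatten = (X ++ [B]).flatten ++ v :: (C :: Y).flatten := by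
    simp
  have hfl' : (X ++ B :: C :: Y).flatten = (X ++ [B]).flatten ++ (C :: Y).flatten := by simp
  have hlt' : ∀ x ∈ (C :: Y).flatten, x < v := fun x hx => hlt x (by
    rw [hfl']; exact List.mem_append_right _ hx)
  refine ⟨?_, ?_, ?_, ?_, ?_, ?_, ?_⟩
  · simp at hlen ⊢; omega
  · rw [hfl]
    exact perm_range_succ_of_append (hfl' ▸ S.perm)
  · have h0 := S.last
    rcases List.eq_nil_or_concat' Y with rfl | ⟨Y', c, rfl⟩
    · simp only [List.getLast?_append, List.getLast?_cons] at h0 ⊢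
      have hC := h0 C (by simp)
      intro D hD
      obtain rfl : B ++ v :: C = D := by simpa using hD
      rw [List.getLast?_append, List.getLast?_cons, hC]
      rfl
    · rw [show X ++ B :: C :: (Y' ++ [c]) = (X ++ B :: C :: Y') ++ [c] by simp,
        List.getLast?_append] at h0
      rw [show X ++ (B ++ v :: C) :: (Y' ++ [c]) = (X ++ (B ++ v :: C) :: Y') ++ [c] by simp,
        List.getLast?_append]
      simpa using h0
  · intro D hD
    have hD' : D = B ++ v :: C ∨ D ∈ X ++ B :: C :: Y := by
      simp at hD ⊢; tauto
    rcases hD' with rfl | hD'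
    · refine (S.block B (by simp)).merge (S.block C (by simp)) hP ?_ ?_ <;>
      · intro x hx
        exact hlt x (by simp [hx])
    · exact S.block D hD'
  · have hle : a' ≤ X.length := by
      simp only [insertPos] at hj; split_ifs at hj <;> omega
    refine S.inc₁.sublist (List.Sublist.flatten ?_)
    rw [List.take_append_of_le_length hle, ← List.take_append_of_le_length hle]
    exact (List.take_prefix_take_left h₁).sublist
  · have h4 := S.inc₂
    rcases eq_or_ne Y [] with rfl | hY
    · refine h4.sublist (List.Sublist.flatten ?_)
      simp [List.dropLast_append_of_ne_nil]
    · have hYl := List.length_pos_iff.2 hY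
      have hXB : NoInc 1 (X ++ [B]).flatten := by
        refine S.inc₁.sublist (List.Sublist.flatten ?_)
        have : X.length + 1 ≤ a := by
          simp only [insertPos] at hj
          simp at hj
          split_ifs at hj <;> omega
        rw [show X ++ B :: C :: Y = (X ++ [B]) ++ C :: Y by simp, List.take_append,
          List.take_of_length_le (by simpa using this)]
        exact List.sublist_append_left _ _
      have hd : (X ++ B :: C :: Y).dropLast.flatten =
          (X ++ [B]).flatten ++ (C :: Y.dropLast).flatten := by
        simp [List.dropLast_append_of_ne_nil, List.dropLast_cons_of_ne_nil, hY]
      have hd' : (X ++ (B ++ v :: C) :: Y).dropLast.flatten =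
          (X ++ [B]).flatten ++ v :: (C :: Y.dropLast).flatten := by
        simp [List.dropLast_append_of_ne_nil, List.dropLast_cons_of_ne_nil, hY]
      rw [hd']
      refine hXB.insert_max (hd ▸ h4) fun x hx => hlt' x ?_
      exact ((List.dropLast_sublist Y).cons_cons C).flatten.subset hx
  · rw [hfl]
    refine NoInc.insert_max ?_ (hfl' ▸ S.inc₃) hlt'
    refine S.inc₂.sublist (List.Sublist.flatten ?_)
    simp [List.dropLast_append_of_ne_nil]

/-- The path `s` with heights `h`, together with the admissible sequences `a` of numbers of gaps
preceded by no ascent. -/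
structure IsAdmissible (N : ℕ) (s : ℕ → Bool) (h a : ℕ → ℕ) : Prop where
  height_zero : h 0 = 0
  height_end : h N = 0
  zero : a 0 = 0
  up : ∀ k < N, s k = true → h (k + 1) = h k + 1 ∧ 1 ≤ a (k + 1) ∧ a (k + 1) ≤ a k + 1
  down : ∀ k < N, s k = false → h k = h (k + 1) + 1 ∧ a (k + 1) ≤ a k ∧ a (k + 1) ≤ h (k + 1)

theorem IsAdmissible.le {N : ℕ} {s : ℕ → Bool} {h a : ℕ → ℕ} (A : IsAdmissible N s h a) :
    ∀ k ≤ N, a k ≤ h k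
  | 0, _ => by simp [A.zero]
  | k + 1, hk => by
    have ih := A.le k (by omega)
    cases hs : s k
    · exact (A.down k hk hs).2.2
    · have := A.up k hk hs
      omega

/-- The values that are to become valleys, including the final sentinel `0`. -/
def IsBottom (s : ℕ → Bool) (x : ℕ) : Prop := x = 0 ∨ s (x - 1) = true

theorem IsAdmissible.isState {N : ℕ} {s : ℕ → Bool} {h a : ℕ → ℕ} (A : IsAdmissible N s h a) :
    ∀ k ≤ N, IsState (IsBottom s) (k + 1) (h k) (a k) (blocks s a k)
  | 0, _ => by
    rw [A.height_zero, A.zero]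
    refine ⟨by simp [blocks], by simp [blocks], by simp [blocks], ?_, ?_, ?_, ?_⟩
    · intro B hB
      obtain rfl : B = [0] := by simpa [blocks] using hB
      exact isBlock_singleton (Or.inl rfl)
    · simpa using noInc_nil 1
    · simpa [blocks] using noInc_nil 2
    · exact fun t ht _ => ht.length_le.trans (by simp [blocks])
  | k + 1, hk => by
    have ih := A.isState k (by omega)
    rw [blocks]
    cases hs : s k
    · obtain ⟨h₁, h₂, h₃⟩ := A.down k hk hs
      rw [h₁] at ih
      exact (ih.down (by simp [IsBottom, hs]) h₂ h₃).2
    · obtain ⟨h₁, h₂, h₃⟩ := A.up k hk hs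
      rw [h₁]
      exact ih.up (Or.inr hs) (A.le k (by omega)) h₂ h₃

theorem append_cons_inj_of_unique {α : Type*} {q : α → Prop} {b b' : α} (hb : q b) (hb' : q b') :
    ∀ {X X' Y Y' : List α}, (∀ x ∈ X, ¬q x) → (∀ x ∈ X', ¬q x) →
      X ++ b :: Y = X' ++ b' :: Y' → X = X' ∧ b = b' ∧ Y = Y'
  | [], [], _, _, _, _, h => by simpa using h
  | [], x :: X', _, _, _, h', h => by
    simp only [List.nil_append, List.cons_append, List.cons.injEq] at h
    exact absurd (h.1 ▸ hb) (h' x (by simp))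
  | x :: X, [], _, _, h', _, h => by
    simp only [List.nil_append, List.cons_append, List.cons.injEq] at h
    exact absurd (h.1 ▸ hb') (h' x (by simp))
  | x :: X, x' :: X', _, _, h₁, h₂, h => by
    simp only [List.cons_append, List.cons.injEq] at h
    obtain ⟨rfl, h⟩ := h
    obtain ⟨rfl, rfl, rfl⟩ := append_cons_inj_of_unique hb hb'
      (fun y hy => h₁ y (by simp [hy])) (fun y hy => h₂ y (by simp [hy])) h
    simp

theorem insertValue_true_inj {v j j' : ℕ} {bs bs' : List (List ℕ)} (hv : v ∉ bs.flatten)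
    (hv' : v ∉ bs'.flatten) (hj : j ≤ bs.length) (hj' : j' ≤ bs'.length)
    (h : insertValue v true j bs = insertValue v true j' bs') : bs = bs' ∧ j = j' := by
  obtain ⟨h₁, -, h₂⟩ := append_cons_inj_of_unique (q := (v ∈ ·)) (by simp) (by simp)
    (fun x hx hvx => hv (List.mem_flatten.2 ⟨x, List.mem_of_mem_take hx, hvx⟩))
    (fun x hx hvx => hv' (List.mem_flatten.2 ⟨x, List.mem_of_mem_take hx, hvx⟩)) h
  refine ⟨?_, ?_⟩
  · rw [← List.take_append_drop j bs, ← List.take_append_drop j' bs', h₁, h₂]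
  · simpa [hj, hj'] using congrArg List.length h₁

theorem insertValue_false_inj {v j j' : ℕ} {bs bs' : List (List ℕ)} (hv : v ∉ bs.flatten)
    (hv' : v ∉ bs'.flatten) (hj : j + 1 < bs.length) (hj' : j' + 1 < bs'.length)
    (h : insertValue v false j bs = insertValue v false j' bs') : bs = bs' ∧ j = j' := by
  obtain ⟨X, B, C, Y, rfl, hX, hins⟩ := exists_split_pair hj
  obtain ⟨X', B', C', Y', rfl, hX', hins'⟩ := exists_split_pair hj'
  rw [hins, hins'] at h
  obtain ⟨rfl, h₁, rfl⟩ := append_cons_inj_of_unique (q := (v ∈ ·)) (by simp) (by simp)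
    (fun x hx hvx => hv (by simp; exact Or.inl ⟨x, hx, hvx⟩))
    (fun x hx hvx => hv' (by simp; exact Or.inl ⟨x, hx, hvx⟩)) h
  obtain ⟨rfl, -, rfl⟩ := append_cons_inj_of_unique (q := (· = v)) rfl rfl
    (fun x hx hvx => hv (by simp; grind)) (fun x hx hvx => hv' (by simp; grind)) h₁
  exact ⟨rfl, hX.symm.trans hX'⟩

theorem IsState.notMem {P : ℕ → Prop} {v h a : ℕ} {bs : List (List ℕ)} (S : IsState P v h a bs) :
    v ∉ bs.flatten := fun hv => (S.lt hv).false

theorem IsAdmissible.blocks_inj {N : ℕ} {s : ℕ → Bool} {h a a' : ℕ → ℕ}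
    (A : IsAdmissible N s h a) (A' : IsAdmissible N s h a')
    (hN : blocks s a N = blocks s a' N) : ∀ k ≤ N, a k = a' k := by
  have step : ∀ k < N, blocks s a (k + 1) = blocks s a' (k + 1) →
      blocks s a k = blocks s a' k ∧
        (a k = a' k → a (k + 1) = a' (k + 1)) := by
    intro k hk e
    have S := A.isState k hk.le
    have S' := A'.isState k hk.le
    have hl := S.length
    have hl' := S'.length
    have hle := A.le k hk.le
    have hle' := A'.le k hk.le
    rw [blocks, blocks] at e
    cases hs : s k
    · obtain ⟨h₁, h₂, h₃⟩ := A.down k hk hs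
      obtain ⟨-, h₂', h₃'⟩ := A'.down k hk hs
      rw [h₁] at S S'
      rw [hs] at e
      have hP : ¬IsBottom s (k + 1) := by simp [IsBottom, hs]
      obtain ⟨e₁, e₂⟩ := insertValue_false_inj S.notMem S'.notMem
        (S.down hP h₂ h₃).1 (S'.down hP h₂' h₃').1 e
      refine ⟨e₁, fun _ => ?_⟩
      simp only [insertPos] at e₂
      split_ifs at e₂ <;> omega
    · obtain ⟨h₁, h₂, h₃⟩ := A.up k hk hs
      obtain ⟨-, h₂', h₃'⟩ := A'.up k hk hs
      rw [hs] at e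
      obtain ⟨e₁, e₂⟩ := insertValue_true_inj S.notMem S'.notMem
        (by simp only [insertPos]; split_ifs <;> omega)
        (by simp only [insertPos]; split_ifs <;> omega) e
      refine ⟨e₁, fun _ => ?_⟩
      simp only [insertPos] at e₂
      split_ifs at e₂ <;> omega
  have back : ∀ k ≤ N, blocks s a k = blocks s a' k := by
    intro k hk
    induction hk using Nat.decreasingInduction with
    | self => exact hN
    | of_succ k hk ih => exact (step k hk ih).1
  intro k
  induction k with
  | zero => intro _; rw [A.zero, A'.zero]
  | succ k ih => exact fun hk => (step k hk (back (k + 1) hk)).2 (ih (by omega))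

theorem IsBlock.getElem_iff {P : ℕ → Prop} {B : List ℕ} (hB : IsBlock P B) :
    ∀ i (hi : i < B.length), P B[i] ↔ Even i
  | 0, hi => by
    have := hB.head B[0] (by rw [List.head?_eq_getElem?, List.getElem?_eq_getElem hi]; rfl)
    simpa using this
  | i + 1, hi => by
    have ih := hB.getElem_iff i (by omega)
    have hR := List.isChain_iff_getElem.1 hB.chain i hi
    rw [Nat.even_add_one, ← ih]
    rcases hR with h | h <;> tauto

/-- The permutation word obtained from an admissible sequence. -/
def blocksWord (N : ℕ) (s : ℕ → Bool) (a : ℕ → ℕ) : List ℕ := (blocks s a N).flatten.dropLast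

theorem IsAdmissible.blocks_end {N : ℕ} {s : ℕ → Bool} {h a : ℕ → ℕ} (A : IsAdmissible N s h a) :
    blocks s a N = [blocksWord N s a ++ [0]] := by
  have S := A.isState N le_rfl
  have hl := S.length
  rw [A.height_end, zero_add, List.length_eq_one_iff] at hl
  obtain ⟨B, hB⟩ := hl
  have h0 := S.last B (by simp [hB])
  simp only [blocksWord, hB, List.flatten_singleton]
  rw [List.dropLast_append_getLast? 0 h0]

theorem letter_eq_getElem {w : List ℕ} {i : ℕ} (hi : i < w.length) : letter w (i + 1) = w[i] := by
  simp [letter, List.getD_eq_getElem?_getD, hi]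

theorem avoids1234_of_noInc {w : List ℕ} (h : NoInc 3 w) : Avoids1234 w := by
  rintro ⟨p, q, r, s, hp, hpq, hqr, hrs, hs, h₁, h₂, h₃⟩
  obtain ⟨p, rfl⟩ := Nat.exists_eq_add_of_le' hp
  obtain ⟨q, rfl⟩ := Nat.exists_eq_add_of_le' (show 1 ≤ q by omega)
  obtain ⟨r, rfl⟩ := Nat.exists_eq_add_of_le' (show 1 ≤ r by omega)
  obtain ⟨s, rfl⟩ := Nat.exists_eq_add_of_le' (show 1 ≤ s by omega)
  rw [letter_eq_getElem (by omega), letter_eq_getElem (by omega)] at h₁ h₂ h₃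
  have hsub := List.map_getElem_sublist (l := w)
    (is := [⟨p, by omega⟩, ⟨q, by omega⟩, ⟨r, by omega⟩, ⟨s, by omega⟩])
    (by simp; omega)
  have := h _ hsub (by simp; omega)
  simp at this

theorem IsAdmissible.isA {n : ℕ} {s : ℕ → Bool} {h a : ℕ → ℕ}
    (A : IsAdmissible (2 * n) s h a) :
    IsA n (blocksWord (2 * n) s a) ∧
      {u : ℕ | ∃ i, 1 ≤ i ∧ i ≤ n ∧ letter (blocksWord (2 * n) s a) (2 * i - 1) = u} =
        {u : ℕ | 1 ≤ u ∧ u ≤ 2 * n ∧ s (u - 1) = true} := by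
  have S := A.isState (2 * n) le_rfl
  have hB := A.blocks_end
  rw [hB] at S
  generalize blocksWord (2 * n) s a = w at S ⊢
  have blk := S.block (w ++ [0]) (by simp)
  have perm : (w ++ [0]).Perm (List.range (2 * n + 1)) := by simpa using S.perm
  have hlen : w.length = 2 * n := by simpa using perm.length_eq
  have hnd : (w ++ [0]).Nodup := perm.nodup_iff.2 List.nodup_range
  have h0 : 0 ∉ w := fun h => (List.nodup_append.1 hnd).2.2 0 h 0 (by simp) rfl
  have hmem : ∀ k, k ∈ w ↔ 1 ≤ k ∧ k ≤ 2 * n := by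
    intro k
    have := perm.mem_iff (a := k)
    simp only [List.mem_append, List.mem_singleton, List.mem_range] at this
    rcases Nat.eq_zero_or_pos k with rfl | hk
    · simp [h0]
    · rw [or_iff_left (by omega)] at this
      rw [this]; omega
  have hbot : ∀ i (hi : i < w.length), IsBottom s w[i] ↔ Even i := by
    intro i hi
    have := blk.getElem_iff i (by simp; omega)
    rwa [List.getElem_append_left hi] at this
  have hrel : ∀ i (hi : i + 1 < w.length), AltRel (IsBottom s) w[i] w[i + 1] := by
    intro i hi
    have := List.isChain_iff_getElem.1 blk.chain i (by simp; omega)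
    rwa [List.getElem_append_left, List.getElem_append_left hi] at this
  refine ⟨⟨⟨hlen, by simpa using hmem⟩, ⟨?_, ?_⟩, ?_⟩, ?_⟩
  · intro i h₁ h₂
    obtain ⟨i, rfl⟩ := Nat.exists_eq_add_of_le' h₁
    have hi : 2 * i + 1 < w.length := by omega
    rw [show 2 * (i + 1) - 1 = 2 * i + 1 by omega, show 2 * (i + 1) = 2 * i + 1 + 1 by omega,
      letter_eq_getElem hi, letter_eq_getElem (by omega)]
    rcases hrel (2 * i) hi with h | h
    · exact h.2.2
    · exact absurd ((hbot (2 * i) (by omega)).2 (by simp)) h.1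
  · intro i h₁ h₂
    obtain ⟨i, rfl⟩ := Nat.exists_eq_add_of_le' h₁
    have hi : 2 * i + 1 + 1 < w.length := by omega
    rw [show 2 * (i + 1) = 2 * i + 1 + 1 by omega,
      letter_eq_getElem hi, letter_eq_getElem (by omega)]
    rcases hrel (2 * i + 1) hi with h | h
    · exact absurd ((hbot (2 * i + 1) (by omega)).1 h.1) (by simp)
    · exact h.2.2
  · exact avoids1234_of_noInc (S.inc₃.sublist (by simp))
  · ext u
    simp only [Set.mem_ofPred_eq]
    constructor
    · rintro ⟨i, h₁, h₂, rfl⟩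
      obtain ⟨i, rfl⟩ := Nat.exists_eq_add_of_le' h₁
      have hi : 2 * i < w.length := by omega
      rw [show 2 * (i + 1) - 1 = 2 * i + 1 by omega, letter_eq_getElem hi]
      obtain ⟨m₁, m₂⟩ := (hmem _).1 (List.getElem_mem hi)
      exact ⟨m₁, m₂, ((hbot (2 * i) hi).2 (by simp)).resolve_left (by omega)⟩
    · rintro ⟨h₁, h₂, hu⟩
      obtain ⟨i, hi, rfl⟩ := List.getElem_of_mem ((hmem u).2 ⟨h₁, h₂⟩)
      obtain ⟨j, hj⟩ := (hbot i hi).1 (Or.inr hu)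
      refine ⟨j + 1, by omega, by omega, ?_⟩
      rw [show 2 * (j + 1) - 1 = i + 1 by omega, letter_eq_getElem hi]

/-- The number of gaps preceded by no ascent after `k` steps, as prescribed by the weights. -/
def ascentFree (p : WDP) : ℕ → ℕ
  | 0 => 0
  | k + 1 =>
    if p.steps.getD k false = true then ht p.steps (k + 1) - p.weights.getD k 0
    else p.weights.getD k 0

theorem ht_succ {s : List Bool} (hs : IsDyck s) {k : ℕ} (hk : k < s.length) :
    (s.getD k false = true → ht s (k + 1) = ht s k + 1) ∧
      (s.getD k false = false → ht s k = ht s (k + 1) + 1) := by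
  have h₁ := hs.1 k
  have h₂ := hs.1 (k + 1)
  simp only [ht, List.getD_eq_getElem?_getD, List.getElem?_eq_getElem hk, Option.getD_some]
  rw [List.take_succ_eq_append_getElem hk] at h₂ ⊢
  simp only [List.count_append] at h₂ ⊢
  constructor <;> intro h <;> simp [h] at h₂ ⊢ <;> omega

theorem IsWD.isAdmissible {n : ℕ} {p : WDP} (hp : IsWD n p) :
    IsAdmissible (2 * n) (fun k => p.steps.getD k false) (ht p.steps) (ascentFree p) := by
  obtain ⟨hs, -, hd, hw, huu, hdd, hud, hdu⟩ := hp
  refine ⟨by simp [ht], ?_, rfl, ?_, ?_⟩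
  · rw [ht, ← hs, List.take_length, hd.2, Nat.sub_self]
  · intro k hk hu
    have h₁ := (ht_succ hd (hs ▸ hk)).1 hu
    have h₂ := hw k hk
    refine ⟨h₁, ?_, ?_⟩
    · simp only [ascentFree, hu, if_true]; omega
    · cases k with
      | zero => simp only [ascentFree, hu, if_true, h₁]; simp [ht]
      | succ k =>
        have h₃ := hw k (by omega)
        simp only [ascentFree]
        cases hu' : p.steps.getD k false
        · have := hdu k hk hu' hu
          simp only [hu, if_true, Bool.false_eq_true, if_false]
          omega
        · have := huu k hk hu' hu
          simp only [hu, if_true]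
          omega
  · intro k hk hu
    have h₁ := (ht_succ hd (hs ▸ hk)).2 hu
    have h₂ := hw k hk
    refine ⟨h₁, ?_, ?_⟩
    · cases k with
      | zero => simp [ht] at h₁
      | succ k =>
        have h₃ := hw k (by omega)
        simp only [ascentFree]
        cases hu' : p.steps.getD k false
        · have := hdd k hk hu' hu
          simpa only [hu, Bool.false_eq_true, if_false] using this
        · have := hud k hk hu' hu
          simp only [hu, if_true, Bool.false_eq_true, if_false]
          omega
    · simp only [ascentFree, hu, Bool.false_eq_true, if_false]
      omega

theorem eq_of_getD_eq {α : Type*} {l l' : List α} {N : ℕ} (d : α) (hl : l.length = N)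
    (hl' : l'.length = N) (h : ∀ k < N, l.getD k d = l'.getD k d) : l = l' := by
  refine List.ext_getElem (hl.trans hl'.symm) fun k h₁ h₂ => ?_
  have := h k (hl ▸ h₁)
  rwa [List.getD_eq_getElem _ _ h₁, List.getD_eq_getElem _ _ h₂] at this

theorem IsWD.eq_of_word_eq {n : ℕ} {p p' : WDP} (hp : IsWD n p) (hp' : IsWD n p')
    (h : blocksWord (2 * n) (fun k => p.steps.getD k false) (ascentFree p) =
      blocksWord (2 * n) (fun k => p'.steps.getD k false) (ascentFree p')) : p = p' := by
  have A := hp.isAdmissible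
  have A' := hp'.isAdmissible
  have hs : p.steps = p'.steps := by
    refine eq_of_getD_eq false hp.1 hp'.1 fun k hk => ?_
    have e := A.isA.2.symm.trans ((by rw [h]) : _ = _) |>.trans A'.isA.2
    have := Set.ext_iff.1 e (k + 1)
    simp only [Set.mem_ofPred_eq, Nat.add_sub_cancel] at this
    rw [Bool.eq_iff_iff]
    grind
  obtain ⟨s, w⟩ := p
  obtain ⟨s', w'⟩ := p'
  obtain rfl : s = s' := hs
  have ha := A.blocks_inj A' (by rw [A.blocks_end, A'.blocks_end, h])
  have hw : w = w' := by
    refine eq_of_getD_eq 0 hp.2.1 hp'.2.1 fun k hk => ?_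
    have e := ha (k + 1) hk
    have h₁ := hp.2.2.2.1 k hk
    have h₂ := hp'.2.2.2.1 k hk
    simp only [ascentFree] at e h₁ h₂
    split_ifs at e <;> omega
  rw [hw]

/-- There is an injection from `WD_{2n}` into `A_{2n}(1234)` sending each
weighted Dyck path to a permutation whose set of bottom elements (values at
odd positions) equals the set of positions of the up-steps of the path. -/
theorem exists_injection_WD_A (n : ℕ) (hn : 1 ≤ n) :
    ∃ β : {p : WDP // IsWD n p} → {w : List ℕ // IsA n w},
      Function.Injective β ∧
      ∀ p : {p : WDP // IsWD n p},
        {u : ℕ | ∃ i, 1 ≤ i ∧ i ≤ n ∧ letter (β p).1 (2 * i - 1) = u} =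
        {u : ℕ | 1 ≤ u ∧ u ≤ 2 * n ∧ p.1.steps.getD (u - 1) false = true} := by
  refine ⟨fun p => ⟨blocksWord (2 * n) (fun k => p.1.steps.getD k false) (ascentFree p.1),
    p.2.isAdmissible.isA.1⟩, ?_, fun p => p.2.isAdmissible.isA.2⟩
  intro p p' h
  exact Subtype.ext (p.2.eq_of_word_eq p'.2 (Subtype.ext_iff.1 h))
end
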